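/- arXiv:2509.01520 — 7 statements merged into one kernel-verified Lean document; each statement's English description precedes it below -/
import Mathlib

section
/- Let U be a unicyclic graph on n vertices whose girth g satisfies g ≥ n − 2 (that is, g ∈ {n−2, n−1, n}). Then U is degree-similar determined: every graph on the same vertex set that is degree-similar to U is isomorphic to U. -/
open scoped Classical

/-- The diagonal degree matrix of a graph, over `ℝ`. -/
noncomputable def degMatrix {V : Type*} [Fintype V] [DecidableEq V] (G : SimpleGraph V) :
    Matrix V V ℝ :=
  Matrix.diagonal fun v => (G.degree v : ℝ)

/-- Two graphs on a common vertex set are degree-similar if some invertible real matrix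
simultaneously conjugates the adjacency matrix of one to that of the other, and the
degree matrix of one to that of the other. -/
noncomputable def DegreeSimilar {V : Type*} [Fintype V] [DecidableEq V]
    (G₁ G₂ : SimpleGraph V) : Prop :=
  ∃ M : Matrix V V ℝ, IsUnit M.det ∧
    M⁻¹ * G₁.adjMatrix ℝ * M = G₂.adjMatrix ℝ ∧
    M⁻¹ * degMatrix G₁ * M = degMatrix G₂

/-- A finite graph is unicyclic if it is connected and its number of edges equals its
number of vertices. -/
noncomputable def Unicyclic {V : Type*} [Fintype V] [DecidableEq V]
    (G : SimpleGraph V) : Prop :=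
  G.Connected ∧ G.edgeFinset.card = Fintype.card V

theorem exists_cycle_param {W : Type*} [Fintype W] (H : SimpleGraph W) (hc : H.Connected)
    (h2 : ∀ v, H.degree v = 2) (p : W) :
    ∃ f : ℤ → W, f.Surjective ∧ (∀ i j, f i = f j ↔ (Fintype.card W : ℤ) ∣ i - j) ∧
      (∀ i x, H.Adj (f i) x ↔ x = f (i + 1) ∨ x = f (i - 1)) ∧ f 0 = p := by
  have hab : ∀ v, ∃ a b, a ≠ b ∧ ∀ x, H.Adj v x ↔ x = a ∨ x = b := by
    intro v
    have := h2 v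
    rw [← SimpleGraph.card_neighborFinset_eq_degree, Finset.card_eq_two] at this
    obtain ⟨a, b, hne, h⟩ := this
    refine ⟨a, b, hne, fun x => ?_⟩
    rw [← SimpleGraph.mem_neighborFinset, h]
    simp
  choose a b hne hadj using hab
  let s : W → Equiv.Perm W := fun v => Equiv.swap (a v) (b v)
  have hss : ∀ v x, s v (s v x) = x := fun v x => by
    simp only [s, ← Equiv.Perm.mul_apply, Equiv.swap_mul_self, Equiv.Perm.one_apply]
  have hs : ∀ v x y, H.Adj v x → (H.Adj v y ↔ y = x ∨ y = s v x) := by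
    intro v x y hx
    rcases (hadj v x).1 hx with rfl | rfl
    · simp [s, hadj]
    · simp [s, hadj, or_comm]
  have hsn : ∀ v x, H.Adj v x → s v x ≠ x := by
    intro v x hx
    rcases (hadj v x).1 hx with h | h
    · simp [s, h, (hne v).symm]
    · simp [s, h, hne v]
  let σ : Equiv.Perm (W × W) :=
    { toFun := fun d => (d.2, s d.2 d.1)
      invFun := fun d => (s d.1 d.2, d.1)
      left_inv := fun d => by simp [hss]
      right_inv := fun d => by simp [hss] }
  let g : ℤ → W × W := fun i => (σ ^ i) (p, a p)
  let f : ℤ → W := fun i => (g i).1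
  have hg1 : ∀ i, g (i + 1) = σ (g i) := fun i => by
    simp only [g]; rw [add_comm, zpow_add, zpow_one]; rfl
  have hgf : ∀ i, g i = (f i, f (i + 1)) := fun i => by
    ext
    · rfl
    · simp only [f]; rw [hg1]; rfl
  have hf2 : ∀ i, f (i + 2) = s (f (i + 1)) (f i) := fun i => by
    have h := hg1 i
    rw [hgf, hgf] at h
    have := congrArg Prod.snd h
    rw [add_assoc] at this
    exact this
  have hf0 : f 0 = p := rfl
  have hf1 : f 1 = a p := by
    have h := hgf 0
    exact (congrArg Prod.snd h).symm
  have hfa : ∀ i, H.Adj (f i) (f (i + 1)) := by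
    have step : ∀ i, H.Adj (f i) (f (i + 1)) ↔ H.Adj (f (i + 1)) (f (i + 1 + 1)) := by
      intro i
      have e : f (i + 1 + 1) = s (f (i + 1)) (f i) := by rw [← hf2, add_assoc]; rfl
      rw [e]
      constructor
      · intro h
        exact (hs _ _ _ h.symm).2 (Or.inr rfl)
      · intro h
        exact ((hs _ _ _ h).2 (Or.inr (hss _ _).symm)).symm
    intro i
    induction i using Int.induction_on with
    | zero => rw [zero_add, hf0, hf1]; exact (hadj _ _).2 (Or.inl rfl)
    | succ i ih => exact (step _).1 ih
    | pred i ih => exact (step _).2 (by simpa using ih)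
  have hfn : ∀ i x, H.Adj (f i) x ↔ x = f (i + 1) ∨ x = f (i - 1) := by
    intro i x
    have h1 := (hfa (i - 1)).symm
    have h2 := hf2 (i - 1)
    rw [sub_add_cancel] at h1 h2
    rw [hs _ _ _ h1, ← h2, or_comm, show i - 1 + 2 = i + 1 by ring]
  have hfne : ∀ i, f (i + 1) ≠ f (i - 1) := by
    intro i
    have h1 := (hfa (i - 1)).symm
    have h2 := hf2 (i - 1)
    rw [sub_add_cancel] at h1 h2
    rw [show i + 1 = i - 1 + 2 by ring, h2]
    exact hsn _ _ h1
  have hfsurj : f.Surjective := by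
    intro x
    obtain ⟨w⟩ := hc.preconnected p x
    have : ∀ (u v : W) (w : H.Walk u v), (∃ i, f i = u) → ∃ i, f i = v := by
      intro u v w
      induction w with
      | nil => exact id
      | cons h _ ih =>
        rintro ⟨i, rfl⟩
        rcases (hfn _ _).1 h with h | h
        · exact ih ⟨_, h.symm⟩
        · exact ih ⟨_, h.symm⟩
    exact this _ _ w ⟨0, hf0⟩
  have hforward : ∀ i j, i ≤ j → f i = f j → f (i + 1) = f (j + 1) := by
    intro i j hij h
    by_contra hcon
    have h1 : f (i + 1) = f (j - 1) := by
      have := hfa i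
      rw [h, hfn] at this
      exact this.resolve_left hcon
    have hk : ∀ k : ℕ, f (i + k) = f (j - k) ∧ f (i + k + 1) = f (j - k - 1) := by
      intro k
      induction k with
      | zero => simpa using ⟨h, h1⟩
      | succ k ih =>
        have e := hf2 (j - k - 2)
        have e' := hf2 (i + k)
        rw [show j - k - 2 + 1 = j - (k : ℤ) - 1 by ring, show j - k - 2 + 2 = j - (k : ℤ) by ring] at e
        push_cast
        rw [← add_assoc, show j - ((k : ℤ) + 1) = j - k - 1 by ring]
        refine ⟨ih.2, ?_⟩
        rw [show i + k + 1 + 1 = i + (k : ℤ) + 2 by ring, e', ih.1, ih.2, e, hss]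
        congr 1; ring
    obtain ⟨n, hn⟩ := Int.eq_ofNat_of_zero_le (sub_nonneg.2 hij)
    obtain rfl : j = i + n := by omega
    obtain ⟨c, hcc⟩ := Nat.even_or_odd' n
    rcases hcc with rfl | rfl
    · have := (hk c).2
      apply hfne (i + c)
      rw [this]; congr 1; push_cast; ring
    · have := (hk c).2
      have h3 := hfa (i + c)
      rw [this] at h3
      apply h3.ne
      congr 1; push_cast; ring
  have hforward' : ∀ i j, f i = f j → f (i + 1) = f (j + 1) := by
    intro i j h
    rcases le_total i j with h' | h'
    · exact hforward i j h' h
    · exact (hforward j i h' h.symm).symm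
  have hper : ∀ i j, f i = f j ↔ (σ ^ (i - j)) (p, a p) = (p, a p) := by
    intro i j
    have h1 : f i = f j ↔ g i = g j := by
      rw [hgf, hgf, Prod.mk.injEq]
      exact ⟨fun h => ⟨h, hforward' i j h⟩, fun h => h.1⟩
    rw [h1]
    have : σ ^ i = σ ^ j * σ ^ (i - j) := by rw [← zpow_add]; congr 1; ring
    simp only [g]
    rw [this, Equiv.Perm.mul_apply]
    exact (Equiv.injective _).eq_iff
  set T := Function.minimalPeriod (fun x => σ • x) (p, a p) with hT
  have hdvd : ∀ i j, f i = f j ↔ (T : ℤ) ∣ i - j := by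
    intro i j
    rw [hper, ← MulAction.zpow_smul_eq_iff_minimalPeriod_dvd]
    rfl
  have hT0 : T ≠ 0 := by
    intro h0
    have : f.Injective := by
      intro i j h
      rw [hdvd, h0] at h
      simpa [sub_eq_zero] using h
    exact not_injective_infinite_finite f this
  have hcard : T = Fintype.card W := by
    have : Function.Bijective (fun i : Fin T => f (i : ℕ)) := by
      constructor
      · intro i j h
        have h' := (hdvd _ _).1 h
        ext
        have := Int.eq_zero_of_abs_lt_dvd h' (by rw [abs_lt]; constructor <;> omega)
        omega
      · intro x
        obtain ⟨i, rfl⟩ := hfsurj x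
        have hp : (0 : ℤ) < T := by omega
        have h0 := Int.emod_nonneg i hp.ne'
        have h1 := Int.emod_lt_of_pos i hp
        refine ⟨⟨(i % T).toNat, by omega⟩, ?_⟩
        simp only [hdvd, Int.toNat_of_nonneg h0]
        exact (Int.mod_modEq i T).symm.dvd
    simpa using Fintype.card_of_bijective this
  exact ⟨f, hfsurj, fun i j => hcard ▸ hdvd i j, hfn, hf0⟩

theorem exists_cycle_param_dist {W : Type*} [Fintype W] (H : SimpleGraph W) (hc : H.Connected)
    (h2 : ∀ v, H.degree v = 2) (p q : W) :
    ∃ f : ℤ → W, f.Surjective ∧ (∀ i j, f i = f j ↔ (Fintype.card W : ℤ) ∣ i - j) ∧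
      (∀ i x, H.Adj (f i) x ↔ x = f (i + 1) ∨ x = f (i - 1)) ∧ f 0 = p ∧
      f (H.dist p q) = q := by
  obtain ⟨f, hs, hd, ha, h0⟩ := exists_cycle_param H hc h2 p
  have hwalk : ∀ (u v : W) (w : H.Walk u v) (i : ℤ), f i = u →
      ∃ t : ℤ, |t| ≤ w.length ∧ f (i + t) = v := by
    intro u v w
    induction w with
    | nil => intro i hi; exact ⟨0, by simp, by simpa using hi⟩
    | cons h w ih =>
      rintro i rfl
      rcases (ha _ _).1 h with h | h
      · obtain ⟨t, ht, e⟩ := ih (i + 1) h.symm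
        refine ⟨1 + t, ?_, by rw [← e]; congr 1; ring⟩
        rw [SimpleGraph.Walk.length_cons]; push_cast
        rw [abs_le] at *; omega
      · obtain ⟨t, ht, e⟩ := ih (i - 1) h.symm
        refine ⟨-1 + t, ?_, by rw [← e]; congr 1; ring⟩
        rw [SimpleGraph.Walk.length_cons]; push_cast
        rw [abs_le] at *; omega
  have hlen : ∀ (k : ℕ) (i : ℤ), H.dist (f i) (f (i + k)) ≤ k := by
    intro k i
    induction k with
    | zero => simp
    | succ k ih =>
      have : H.dist (f (i + k)) (f (i + (k + 1 : ℕ))) = 1 := by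
        rw [SimpleGraph.dist_eq_one_iff_adj, ha]
        left; congr 1; push_cast; ring
      have := hc.dist_triangle (u := f i) (v := f (i + k)) (w := f (i + (k + 1 : ℕ)))
      omega
  obtain ⟨w, hw⟩ := hc.exists_walk_length_eq_dist p q
  obtain ⟨t, ht, e⟩ := hwalk p q w 0 h0
  rw [zero_add] at e
  rw [hw] at ht
  rcases le_total 0 t with h | h
  · refine ⟨f, hs, hd, ha, h0, ?_⟩
    obtain ⟨k, rfl⟩ := Int.eq_ofNat_of_zero_le h
    have := hlen k 0
    rw [zero_add, h0, e] at this
    rw [abs_le] at ht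
    rw [show H.dist p q = k by omega]
    exact e
  · refine ⟨fun i => f (-i), fun x => ?_, fun i j => ?_, fun i x => ?_, by simpa using h0, ?_⟩
    · obtain ⟨i, rfl⟩ := hs x
      exact ⟨-i, by simp⟩
    · rw [hd, show -i - -j = -(i - j) by ring, dvd_neg]
    · rw [ha, or_comm, show -i - 1 = -(i + 1) by ring, show -i + 1 = -(i - 1) by ring]
    · obtain ⟨k, hk⟩ := Int.eq_ofNat_of_zero_le (neg_nonneg.2 h)
      have := hlen k t
      rw [show t + k = 0 by omega, h0, e, SimpleGraph.dist_comm] at this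
      rw [abs_le] at ht
      show f (-(H.dist p q : ℤ)) = q
      rw [show -(H.dist p q : ℤ) = t by omega]
      exact e

theorem exists_iso_of_two_regular {W W' : Type*} [Fintype W] [Fintype W'] (H : SimpleGraph W)
    (H' : SimpleGraph W') (hc : H.Connected) (hc' : H'.Connected) (h2 : ∀ v, H.degree v = 2)
    (h2' : ∀ v, H'.degree v = 2) (hcard : Fintype.card W = Fintype.card W') {p q : W} {p' q' : W'}
    (hpq : H.dist p q = H'.dist p' q') : ∃ φ : H ≃g H', φ p = p' ∧ φ q = q' := by
  obtain ⟨f, hs, hd, ha, h0, h1⟩ := exists_cycle_param_dist H hc h2 p q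
  obtain ⟨f', hs', hd', ha', h0', h1'⟩ := exists_cycle_param_dist H' hc' h2' p' q'
  have hff : ∀ i j, f i = f j ↔ f' i = f' j := fun i j => by rw [hd, hd', hcard]
  have he : ∀ i, f' (hs (f i)).choose = f' i := fun i => (hff _ _).1 (hs (f i)).choose_spec
  have hb : Function.Bijective fun x => f' (hs x).choose := by
    constructor
    · intro x y
      obtain ⟨i, rfl⟩ := hs x
      obtain ⟨j, rfl⟩ := hs y
      simp only [he]
      exact (hff _ _).2
    · intro y
      obtain ⟨i, rfl⟩ := hs' y
      exact ⟨f i, he i⟩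
  refine ⟨⟨Equiv.ofBijective _ hb, ?_⟩, ?_, ?_⟩
  · intro x y
    obtain ⟨i, rfl⟩ := hs x
    obtain ⟨j, rfl⟩ := hs y
    simp only [Equiv.ofBijective_apply, he]
    simp only [ha, ha', hff]
  · show f' (hs p).choose = p'
    rw [← h0, he, h0']
  · show f' (hs q).choose = q'
    rw [← h1, he, hpq, h1']

/-- The vertex `l` has `p` as its only neighbour. -/
def IsLeafAt {W : Type*} (H : SimpleGraph W) (l p : W) : Prop :=
  ∀ x, H.Adj l x ↔ x = p

/-- A `Fintype` instance that does not depend on a choice of decidable equality. -/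
noncomputable instance fintypeSubtypeNe {W : Type*} [Fintype W] (l : W) :
    Fintype {x // x ≠ l} :=
  Fintype.ofFinite _

theorem sum_eq_add_sum_subtype_ne {W : Type*} [Fintype W] (f : W → ℕ) (l : W) :
    ∑ x, f x = f l + ∑ x : {x // x ≠ l}, f x := by
  convert Fintype.sum_eq_add_sum_subtype_ne f l

/-- The graph obtained by deleting the vertex `l`. -/
def deleteVertex {W : Type*} (H : SimpleGraph W) (l : W) : SimpleGraph {x // x ≠ l} :=
  H.comap Subtype.val

/-- The inclusion of the graph with a vertex deleted. -/
def deleteVertexEmbedding {W : Type*} (H : SimpleGraph W) (l : W) : deleteVertex H l ↪g H :=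
  SimpleGraph.Embedding.comap ⟨Subtype.val, Subtype.val_injective⟩ H

theorem IsLeafAt.ne {W : Type*} {H : SimpleGraph W} {l p : W} (h : IsLeafAt H l p) : p ≠ l :=
  ((h p).2 rfl).ne'

theorem isLeafAt_of_degree_eq_one {W : Type*} [Fintype W] {H : SimpleGraph W} {l p : W}
    (h : H.degree l = 1) (hp : H.Adj l p) : IsLeafAt H l p := by
  obtain ⟨q, hq, hu⟩ := SimpleGraph.degree_eq_one_iff_existsUnique_adj.1 h
  intro x
  exact ⟨fun hx => (hu x hx).trans (hu p hp).symm, fun hx => hx ▸ hp⟩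

theorem IsLeafAt.degree_eq_one {W : Type*} [Fintype W] {H : SimpleGraph W} {l p : W}
    (h : IsLeafAt H l p) : H.degree l = 1 :=
  SimpleGraph.degree_eq_one_iff_existsUnique_adj.2 ⟨p, (h p).2 rfl, fun x hx => (h x).1 hx⟩

theorem degree_eq_sum {W : Type*} [Fintype W] (H : SimpleGraph W) (v : W) :
    H.degree v = ∑ w, if H.Adj v w then 1 else 0 := by
  rw [← SimpleGraph.card_neighborFinset_eq_degree, SimpleGraph.neighborFinset_eq_filter,
    Finset.card_filter]

theorem degree_deleteVertex {W : Type*} [Fintype W] (H : SimpleGraph W) (l : W)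
    (v : {x // x ≠ l}) :
    H.degree v = (deleteVertex H l).degree v + if H.Adj v l then 1 else 0 := by
  rw [degree_eq_sum, degree_eq_sum, sum_eq_add_sum_subtype_ne _ l, add_comm]
  rfl

theorem IsLeafAt.degree_deleteVertex {W : Type*} [Fintype W] {H : SimpleGraph W} {l p : W}
    (h : IsLeafAt H l p) (v : {x // x ≠ l}) :
    H.degree v = (deleteVertex H l).degree v + if v.1 = p then 1 else 0 := by
  rw [_root_.degree_deleteVertex, SimpleGraph.adj_comm, h]

theorem IsLeafAt.connected {W : Type*} [Fintype W] {H : SimpleGraph W} {l p : W}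
    (h : IsLeafAt H l p) (hc : H.Connected) : (deleteVertex H l).Connected :=
  hc.induce_compl_singleton_of_degree_eq_one h.degree_eq_one

theorem card_deleteVertex {W : Type*} [Fintype W] (l : W) :
    Fintype.card W = Fintype.card {x // x ≠ l} + 1 := by
  have := sum_eq_add_sum_subtype_ne (fun _ : W => 1) l
  simp only [Finset.sum_const, smul_eq_mul, mul_one, Finset.card_univ] at this
  omega

theorem IsLeafAt.sum_degree {W : Type*} [Fintype W] {H : SimpleGraph W} {l p : W}
    (h : IsLeafAt H l p) :
    ∑ v, H.degree v = ∑ v, (deleteVertex H l).degree v + 2 := by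
  rw [sum_eq_add_sum_subtype_ne _ l, h.degree_eq_one]
  simp only [h.degree_deleteVertex, Finset.sum_add_distrib]
  have : ∑ v : {x // x ≠ l}, (if v.1 = p then 1 else 0) = 1 := by
    rw [Finset.sum_eq_single ⟨p, h.ne⟩]
    · simp
    · intro b _ hb
      rw [if_neg fun e => hb (Subtype.ext e)]
    · simp
  omega

theorem IsLeafAt.sum_degree_sq {W : Type*} [Fintype W] {H : SimpleGraph W} {l p : W}
    (h : IsLeafAt H l p) :
    ∑ v, H.degree v ^ 2 = ∑ v, (deleteVertex H l).degree v ^ 2 + 2 * H.degree p := by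
  rw [sum_eq_add_sum_subtype_ne _ l, h.degree_eq_one]
  have hp := h.degree_deleteVertex ⟨p, h.ne⟩
  have e : ∀ v : {x // x ≠ l}, H.degree v ^ 2 = (deleteVertex H l).degree v ^ 2 +
      if v.1 = p then 2 * (deleteVertex H l).degree v + 1 else 0 := by
    intro v
    rw [h.degree_deleteVertex]
    split_ifs <;> ring
  simp only [e, Finset.sum_add_distrib]
  have : ∑ v : {x // x ≠ l}, (if v.1 = p then 2 * (deleteVertex H l).degree v + 1 else 0) =
      2 * (deleteVertex H l).degree ⟨p, h.ne⟩ + 1 := by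
    rw [Finset.sum_eq_single ⟨p, h.ne⟩]
    · simp
    · intro b _ hb
      rw [if_neg fun e => hb (Subtype.ext e)]
    · simp
  rw [if_pos rfl] at hp
  simp only at hp
  omega

theorem IsLeafAt.dist_deleteVertex {W : Type*} [Fintype W] {H : SimpleGraph W} {l p : W}
    (h : IsLeafAt H l p) (hc : H.Connected) (u v : {x // x ≠ l}) :
    (deleteVertex H l).dist u v = H.dist u v := by
  have hc' := h.connected hc
  let r : W → {x // x ≠ l} := fun x => if hx : x = l then ⟨p, h.ne⟩ else ⟨x, hx⟩
  have hr : ∀ x : {x // x ≠ l}, r x = x := fun x => dif_neg x.2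
  have hrl : r l = ⟨p, h.ne⟩ := dif_pos rfl
  have hstep : ∀ x y, H.Adj x y → (deleteVertex H l).dist (r x) (r y) ≤ 1 := by
    intro x y hxy
    by_cases hx : x = l
    · subst hx
      rw [(h y).1 hxy, hrl, hr ⟨p, h.ne⟩]
      simp
    by_cases hy : y = l
    · subst hy
      rw [(h x).1 hxy.symm, hrl, hr ⟨p, h.ne⟩]
      simp
    rw [hr ⟨x, hx⟩, hr ⟨y, hy⟩]
    exact (SimpleGraph.dist_eq_one_iff_adj (G := deleteVertex H l) (u := ⟨x, hx⟩)
      (v := ⟨y, hy⟩).2 hxy).le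
  apply le_antisymm
  · have key : ∀ (x y : W) (w : H.Walk x y), (deleteVertex H l).dist (r x) (r y) ≤ w.length := by
      intro x y w
      induction w with
      | nil => simp
      | @cons x y z hxy w ih =>
        have := hc'.dist_triangle (u := r x) (v := r y) (w := r z)
        have := hstep _ _ hxy
        rw [SimpleGraph.Walk.length_cons]
        omega
    obtain ⟨w, hw⟩ := hc.exists_walk_length_eq_dist u.1 v.1
    simpa only [hr, hw] using key _ _ w
  · obtain ⟨w, hw⟩ := hc'.exists_walk_length_eq_dist u v
    have := SimpleGraph.dist_le (w.map (deleteVertexEmbedding H l).toHom)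
    rw [SimpleGraph.Walk.length_map, hw] at this
    exact this

theorem exists_isLeafAt {W : Type*} [Fintype W] {H : SimpleGraph W} (hc : H.Connected)
    (hs : ∑ v, H.degree v = 2 * Fintype.card W) (h2 : ¬ ∀ v, H.degree v = 2) :
    ∃ l p, IsLeafAt H l p := by
  by_contra hcon
  push Not at hcon
  apply h2
  have hne := hc.nonempty
  have hnt : Nontrivial W := by
    by_contra hnt
    rw [not_nontrivial_iff_subsingleton] at hnt
    simp at hs
  have hge : ∀ v, 2 ≤ H.degree v := by
    intro v
    have h0 := hc.preconnected.degree_pos_of_nontrivial v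
    have h1 : H.degree v ≠ 1 := by
      intro h1
      obtain ⟨p, hp, -⟩ := SimpleGraph.degree_eq_one_iff_existsUnique_adj.1 h1
      exact hcon v p (isLeafAt_of_degree_eq_one h1 hp)
    omega
  have := (Finset.sum_eq_sum_iff_of_le (s := Finset.univ) (f := fun _ : W => 2)
    (g := fun v => H.degree v) fun v _ => hge v).1 (by simp [hs, mul_comm])
  exact fun v => (this v (Finset.mem_univ _)).symm

theorem two_regular_of_sum {W : Type*} [Fintype W] {H : SimpleGraph W}
    (hs : ∑ v, H.degree v = 2 * Fintype.card W) (hq : ∑ v, H.degree v ^ 2 = 4 * Fintype.card W) :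
    ∀ v, H.degree v = 2 := by
  have hs' : ∑ v, (H.degree v : ℤ) = 2 * Fintype.card W := by exact_mod_cast hs
  have hq' : ∑ v, (H.degree v : ℤ) ^ 2 = 4 * Fintype.card W := by exact_mod_cast hq
  have h0 : ∑ v, ((H.degree v : ℤ) - 2) ^ 2 = 0 := by
    have : ∀ v, ((H.degree v : ℤ) - 2) ^ 2 = (H.degree v : ℤ) ^ 2 - 4 * H.degree v + 4 :=
      fun v => by ring
    simp only [this, Finset.sum_add_distrib, Finset.sum_sub_distrib, ← Finset.mul_sum, hs', hq']
    simp
    ring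
  intro v
  have := (Finset.sum_eq_zero_iff_of_nonneg fun v _ => sq_nonneg _).1 h0 v (Finset.mem_univ _)
  have := pow_eq_zero_iff (two_ne_zero) |>.1 this
  omega

theorem girth_le_card_of_embedding {V W : Type*} [Fintype W] {U : SimpleGraph V}
    {H : SimpleGraph W} (hc : H.Connected) (hs : ∑ v, H.degree v = 2 * Fintype.card W)
    (φ : H ↪g U) : U.girth ≤ Fintype.card W := by
  have hac : ¬ H.IsAcyclic := by
    intro ha
    have ht : H.IsTree := ⟨hc, ha⟩
    have := ht.card_edgeFinset
    have := H.sum_degrees_eq_twice_card_edges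
    omega
  simp only [SimpleGraph.IsAcyclic, not_forall, not_not] at hac
  obtain ⟨v, c, hcyc⟩ := hac
  have h1 := SimpleGraph.girth_le_length (hcyc.map (f := φ.toHom) φ.injective)
  have h2 := hcyc.support_nodup.length_le_card
  simp at h1 h2
  omega

theorem IsLeafAt.exists_iso {W W' : Type*} {H : SimpleGraph W} {H' : SimpleGraph W'}
    {l p : W} {l' p' : W'} (h : IsLeafAt H l p) (h' : IsLeafAt H' l' p')
    (φ : deleteVertex H l ≃g deleteVertex H' l') (hφ : φ ⟨p, h.ne⟩ = ⟨p', h'.ne⟩) :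
    ∃ ψ : H ≃g H', ψ l = l' ∧ ∀ x (hx : x ≠ l), ψ x = φ ⟨x, hx⟩ := by
  let F : W → W' := fun x => if hx : x = l then l' else φ ⟨x, hx⟩
  have hFl : F l = l' := dif_pos rfl
  have hF : ∀ x (hx : x ≠ l), F x = φ ⟨x, hx⟩ := fun x hx => dif_neg hx
  have hFp : F p = p' := by rw [hF p h.ne, hφ]
  have hne : ∀ x, x ≠ l → F x ≠ l' := fun x hx => hF x hx ▸ (φ ⟨x, hx⟩).2
  have hinj : F.Injective := by
    intro x y hxy
    by_cases hx : x = l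
    · by_contra hy
      subst hx
      exact hne y (Ne.symm hy) (hxy ▸ hFl)
    by_cases hy : y = l
    · subst hy
      exact absurd (hxy.trans hFl) (hne x hx)
    rw [hF x hx, hF y hy] at hxy
    exact congrArg Subtype.val (φ.injective (Subtype.ext hxy))
  have hsurj : F.Surjective := by
    intro y
    by_cases hy : y = l'
    · exact ⟨l, hFl.trans hy.symm⟩
    · refine ⟨φ.symm ⟨y, hy⟩, ?_⟩
      rw [hF _ (φ.symm ⟨y, hy⟩).2]
      simp
  refine ⟨⟨Equiv.ofBijective F (And.intro hinj hsurj), ?_⟩, hFl, hF⟩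
  intro x y
  change H'.Adj (F x) (F y) ↔ H.Adj x y
  have hleaf : ∀ z, H'.Adj l' (F z) ↔ H.Adj l z := fun z => by
    rw [h, h', ← hFp, hinj.eq_iff]
  by_cases hx : x = l
  · rw [hx, hFl, hleaf]
  by_cases hy : y = l
  · rw [hy, hFl, H'.adj_comm, hleaf, H.adj_comm]
  rw [hF x hx, hF y hy]
  exact φ.map_rel_iff (a := ⟨x, hx⟩) (b := ⟨y, hy⟩)

section Similarity

open scoped Matrix

theorem mulVec_const_of_lapMatrix_similar {V : Type*} [Fintype V] [DecidableEq V]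
    {U G : SimpleGraph V} {M : Matrix V V ℝ} (hL : U.lapMatrix ℝ * M = M * G.lapMatrix ℝ)
    (hU : U.Connected) {f : V → ℝ} (hf : G.lapMatrix ℝ *ᵥ f = 0) (u v : V) :
    (M *ᵥ f) u = (M *ᵥ f) v := by
  have h : U.lapMatrix ℝ *ᵥ (M *ᵥ f) = 0 := by
    rw [Matrix.mulVec_mulVec, hL, ← Matrix.mulVec_mulVec, hf, Matrix.mulVec_zero]
  exact (SimpleGraph.lapMatrix_mulVec_eq_zero_iff_forall_reachable U).1 h u v
    (hU.preconnected u v)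

theorem connected_of_lapMatrix_similar {V : Type*} [Fintype V] [DecidableEq V]
    {U G : SimpleGraph V} {M : Matrix V V ℝ} (hM : IsUnit M.det)
    (hL : U.lapMatrix ℝ * M = M * G.lapMatrix ℝ) (hU : U.Connected) : G.Connected := by
  have hne := hU.nonempty
  refine ⟨fun a b => ?_⟩
  let f : V → ℝ := fun x => if G.Reachable a x then 1 else 0
  have hf : G.lapMatrix ℝ *ᵥ f = 0 := by
    rw [SimpleGraph.lapMatrix_mulVec_eq_zero_iff_forall_reachable]
    intro i j hij
    have : G.Reachable a i ↔ G.Reachable a j :=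
      ⟨fun h => h.trans hij, fun h => h.trans hij.symm⟩
    simp only [f, this]
  have h1 : G.lapMatrix ℝ *ᵥ (fun _ => 1) = 0 := G.lapMatrix_mulVec_const_eq_zero
  have hinj := Matrix.mulVec_injective_of_isUnit ((Matrix.isUnit_iff_isUnit_det M).2 hM)
  set c := (M *ᵥ f) a
  set c' := (M *ᵥ fun _ => (1 : ℝ)) a with hc'
  have hcf : M *ᵥ f = fun _ => c :=
    funext fun x => mulVec_const_of_lapMatrix_similar hL hU hf x a
  have hc1 : (M *ᵥ fun _ => (1 : ℝ)) = fun _ => c' :=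
    funext fun x => mulVec_const_of_lapMatrix_similar hL hU h1 x a
  have hc0 : c' ≠ 0 := by
    intro h0
    have : (fun _ : V => (1 : ℝ)) = 0 := hinj (by
      rw [hc1, h0, Matrix.mulVec_zero]; rfl)
    exact one_ne_zero (congrFun this a)
  have hE : c' • f = c • fun _ => (1 : ℝ) := hinj (by
    rw [Matrix.mulVec_smul, Matrix.mulVec_smul, hcf, hc1]
    ext; simp [mul_comm])
  have hab : f b = f a := mul_left_cancel₀ hc0 ((congrFun hE b).trans (congrFun hE a).symm)
  have ha : f a = 1 := if_pos (SimpleGraph.Reachable.refl a)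
  rw [ha] at hab
  by_contra h
  simp [f, h] at hab

theorem exists_eigenvalue_of_lapMatrix_similar {V : Type*} [Fintype V] [DecidableEq V]
    {U G : SimpleGraph V} {M : Matrix V V ℝ} (hM : IsUnit M.det)
    (hL : U.lapMatrix ℝ * M = M * G.lapMatrix ℝ) (hU : U.Connected) (hG : G.Connected) :
    ∃ c : ℝ, c ≠ 0 ∧ (M *ᵥ fun _ => 1) = (fun _ => c) ∧ ((fun _ => 1) ᵥ* M) = fun _ => c := by
  obtain ⟨a⟩ := hU.nonempty
  have hL' : G.lapMatrix ℝ * Mᵀ = Mᵀ * U.lapMatrix ℝ := by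
    have := congrArg Matrix.transpose hL
    rw [Matrix.transpose_mul, Matrix.transpose_mul, (U.isSymm_lapMatrix (R := ℝ)).eq,
      (G.isSymm_lapMatrix (R := ℝ)).eq] at this
    exact this.symm
  have hinj := Matrix.mulVec_injective_of_isUnit ((Matrix.isUnit_iff_isUnit_det M).2 hM)
  set c := (M *ᵥ fun _ => (1 : ℝ)) a
  set c' := (Mᵀ *ᵥ fun _ => (1 : ℝ)) a
  have hc : (M *ᵥ fun _ => (1 : ℝ)) = fun _ => c :=
    funext fun x => mulVec_const_of_lapMatrix_similar hL hU G.lapMatrix_mulVec_const_eq_zero x a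
  have hc' : ((fun _ => (1 : ℝ)) ᵥ* M) = fun _ => c' := by
    rw [← Matrix.mulVec_transpose]
    exact funext fun x =>
      mulVec_const_of_lapMatrix_similar hL' hG U.lapMatrix_mulVec_const_eq_zero x a
  have hc0 : c ≠ 0 := by
    intro h0
    have : (fun _ : V => (1 : ℝ)) = 0 := hinj (by
      rw [hc, h0, Matrix.mulVec_zero]; rfl)
    exact one_ne_zero (congrFun this a)
  have hcc : c = c' := by
    have h := Matrix.dotProduct_mulVec (fun _ => (1 : ℝ)) M (fun _ => 1)
    rw [hc, hc'] at h
    have hn : (Fintype.card V : ℝ) ≠ 0 := by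
      have : Nonempty V := ⟨a⟩
      exact_mod_cast Fintype.card_ne_zero
    simpa [dotProduct, hn] using h
  exact ⟨c, hc0, hc, hcc ▸ hc'⟩

/-- The relations `R` and `S` are the supports of entrywise nonnegative matrices that are
intertwined by `M`. -/
def Linked {V : Type*} [Fintype V] (M : Matrix V V ℝ) (R S : V → V → Prop) : Prop :=
  ∃ X Y : Matrix V V ℝ, X * M = M * Y ∧ (∀ u v, 0 ≤ X u v) ∧ (∀ u v, 0 ≤ Y u v) ∧
    (∀ u v, X u v ≠ 0 ↔ R u v) ∧ ∀ u v, Y u v ≠ 0 ↔ S u v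

theorem mul_apply_ne_zero_iff {V : Type*} [Fintype V] {X Y : Matrix V V ℝ}
    (hX : ∀ u v, 0 ≤ X u v) (hY : ∀ u v, 0 ≤ Y u v) (u v : V) :
    (X * Y) u v ≠ 0 ↔ ∃ w, X u w ≠ 0 ∧ Y w v ≠ 0 := by
  rw [Matrix.mul_apply, Ne, Finset.sum_eq_zero_iff_of_nonneg fun w _ => mul_nonneg (hX u w) (hY w v)]
  simp

theorem Linked.comp {V : Type*} [Fintype V] {M : Matrix V V ℝ} {R S R' S' : V → V → Prop}
    (h : Linked M R S) (h' : Linked M R' S') :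
    Linked M (fun u v => ∃ w, R u w ∧ R' w v) (fun u v => ∃ w, S u w ∧ S' w v) := by
  obtain ⟨X, Y, e, hX, hY, hR, hS⟩ := h
  obtain ⟨X', Y', e', hX', hY', hR', hS'⟩ := h'
  refine ⟨X * X', Y * Y', ?_, fun u v => ?_, fun u v => ?_, fun u v => ?_, fun u v => ?_⟩
  · rw [Matrix.mul_assoc, e', ← Matrix.mul_assoc, e, Matrix.mul_assoc]
  · exact Finset.sum_nonneg fun w _ => mul_nonneg (hX u w) (hX' w v)
  · exact Finset.sum_nonneg fun w _ => mul_nonneg (hY u w) (hY' w v)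
  · simp only [mul_apply_ne_zero_iff hX hX', hR, hR']
  · simp only [mul_apply_ne_zero_iff hY hY', hS, hS']

theorem linked_degree {V : Type*} [Fintype V] [DecidableEq V] {U G : SimpleGraph V}
    {M : Matrix V V ℝ} (hD : degMatrix U * M = M * degMatrix G) (d : ℕ) :
    Linked M (fun u v => u = v ∧ U.degree u = d) (fun u v => u = v ∧ G.degree u = d) := by
  refine ⟨Matrix.diagonal fun v => if U.degree v = d then 1 else 0,
    Matrix.diagonal fun v => if G.degree v = d then 1 else 0, ?_, ?_, ?_, ?_, ?_⟩
  · ext u v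
    have h := congrFun (congrFun hD u) v
    rw [degMatrix, degMatrix, Matrix.diagonal_mul, Matrix.mul_diagonal, mul_comm] at h
    rw [Matrix.diagonal_mul, Matrix.mul_diagonal]
    by_cases h0 : M u v = 0
    · simp [h0]
    · have := mul_left_cancel₀ h0 h
      rw [Nat.cast_inj] at this
      rw [this, mul_comm]
  all_goals
    intro u v
    simp only [Matrix.diagonal_apply]
    split_ifs <;> simp_all

theorem Linked.degree_mul {V : Type*} [Fintype V] [DecidableEq V] {U G : SimpleGraph V}
    {M : Matrix V V ℝ} {R S : V → V → Prop} (h : Linked M R S)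
    (hD : degMatrix U * M = M * degMatrix G) (d : ℕ) :
    Linked M (fun u v => U.degree u = d ∧ R u v) (fun u v => G.degree u = d ∧ S u v) := by
  simpa [and_assoc] using (linked_degree hD d).comp h

theorem Linked.mul_degree {V : Type*} [Fintype V] [DecidableEq V] {U G : SimpleGraph V}
    {M : Matrix V V ℝ} {R S : V → V → Prop} (h : Linked M R S)
    (hD : degMatrix U * M = M * degMatrix G) (d : ℕ) :
    Linked M (fun u v => R u v ∧ U.degree v = d) (fun u v => S u v ∧ G.degree v = d) := by
  have := h.comp (linked_degree hD d)
  have e : ∀ (R : V → V → Prop) (H : SimpleGraph V) (u v : V),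
      (∃ w, R u w ∧ w = v ∧ H.degree w = d) ↔ R u v ∧ H.degree v = d := fun R H u v =>
    ⟨by rintro ⟨w, h, rfl, h'⟩; exact ⟨h, h'⟩, fun h => ⟨v, h.1, rfl, h.2⟩⟩
  simpa only [e] using this

theorem linked_walk {V : Type*} [Fintype V] [DecidableEq V] {U G : SimpleGraph V}
    {M : Matrix V V ℝ} (hA : U.adjMatrix ℝ * M = M * G.adjMatrix ℝ) (k : ℕ) :
    Linked M (fun u v => ∃ w : U.Walk u v, w.length = k)
      (fun u v => ∃ w : G.Walk u v, w.length = k) := by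
  refine ⟨U.adjMatrix ℝ ^ k, G.adjMatrix ℝ ^ k, ?_, ?_, ?_, ?_, ?_⟩
  · induction k with
    | zero => simp
    | succ k ih => rw [pow_succ, Matrix.mul_assoc, hA, ← Matrix.mul_assoc, ih, Matrix.mul_assoc,
        pow_succ]
  all_goals
    intro u v
    rw [SimpleGraph.adjMatrix_pow_apply_eq_card_walk]
    simp [← Finset.nonempty_iff_ne_empty, Finset.Nonempty, SimpleGraph.mem_finsetWalkLength_iff]

theorem linked_adj {V : Type*} [Fintype V] {U G : SimpleGraph V}
    {M : Matrix V V ℝ} (hA : U.adjMatrix ℝ * M = M * G.adjMatrix ℝ) :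
    Linked M U.Adj G.Adj := by
  refine ⟨U.adjMatrix ℝ, G.adjMatrix ℝ, hA, ?_, ?_, ?_, ?_⟩
  all_goals
    intro u v
    rw [SimpleGraph.adjMatrix_apply]
    split_ifs <;> simp_all

theorem Linked.exists_ne_iff {V : Type*} [Fintype V] [DecidableEq V] {M : Matrix V V ℝ}
    {R S : V → V → Prop} (h : Linked M R S) (hM : IsUnit M.det) {c : ℝ} (hc : c ≠ 0)
    (h1 : (M *ᵥ fun _ => 1) = fun _ => c) (h2 : ((fun _ => 1) ᵥ* M) = fun _ => c) :
    (∃ u v, u ≠ v ∧ R u v) ↔ ∃ u v, u ≠ v ∧ S u v := by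
  obtain ⟨X, Y, e, hX, hY, hR, hS⟩ := h
  have htr : X.trace = Y.trace := by
    have : X = M * Y * M⁻¹ := by rw [← e, Matrix.mul_nonsing_inv_cancel_right _ _ hM]
    rw [this, Matrix.trace_mul_comm, Matrix.nonsing_inv_mul_cancel_left _ _ hM]
  have hsum : ∑ u, ∑ v, X u v = ∑ u, ∑ v, Y u v := by
    have hX1 : (fun _ => (1 : ℝ)) ⬝ᵥ ((X * M) *ᵥ fun _ => 1) = c * ∑ u, ∑ v, X u v := by
      rw [← Matrix.mulVec_mulVec, h1]
      simp [dotProduct, Matrix.mulVec, Finset.mul_sum, mul_comm]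
    have hY1 : (fun _ => (1 : ℝ)) ⬝ᵥ ((M * Y) *ᵥ fun _ => 1) = c * ∑ u, ∑ v, Y u v := by
      rw [← Matrix.mulVec_mulVec, Matrix.dotProduct_mulVec, h2]
      simp [dotProduct, Matrix.mulVec, ← Finset.mul_sum]
    rw [e, hY1] at hX1
    exact (mul_left_cancel₀ hc hX1).symm
  have hoff : ∀ (Z : Matrix V V ℝ) (T : V → V → Prop), (∀ u v, 0 ≤ Z u v) →
      (∀ u v, Z u v ≠ 0 ↔ T u v) →
      ((∃ u v, u ≠ v ∧ T u v) ↔ ∑ u, ∑ v, Z u v - Z.trace ≠ 0) := by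
    intro Z T hZ hT
    have : ∑ u, ∑ v, Z u v - Z.trace = ∑ u, ∑ v, if u ≠ v then Z u v else 0 := by
      rw [Matrix.trace, ← Finset.sum_sub_distrib]
      refine Finset.sum_congr rfl fun u _ => ?_
      simp only [ne_eq, ite_not, Matrix.diag_apply]
      rw [← Finset.sum_erase_eq_sub (Finset.mem_univ u), Finset.sum_ite,
        Finset.sum_const_zero, zero_add]
      refine Finset.sum_congr ?_ fun _ _ => rfl
      ext v
      simp [eq_comm]
    have hnn : ∀ u v, 0 ≤ if u ≠ v then Z u v else 0 := fun u v => by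
      split_ifs
      · exact hZ u v
      · exact le_rfl
    rw [this, Ne, Finset.sum_eq_zero_iff_of_nonneg fun u _ => Finset.sum_nonneg fun v _ => hnn u v]
    simp only [Finset.sum_eq_zero_iff_of_nonneg fun v _ => hnn _ v]
    simp [← hT]
  rw [hoff X R hX hR, hoff Y S hY hS, htr, hsum]

theorem sum_degree_pow_eq {V : Type*} [Fintype V] [DecidableEq V] {U G : SimpleGraph V}
    {M : Matrix V V ℝ} (hM : IsUnit M.det) (hD : degMatrix U * M = M * degMatrix G) (k : ℕ) :
    ∑ v, U.degree v ^ k = ∑ v, G.degree v ^ k := by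
  have h : ∀ k : ℕ, degMatrix U ^ k * M = M * degMatrix G ^ k := by
    intro k
    induction k with
    | zero => simp
    | succ k ih => rw [pow_succ, Matrix.mul_assoc, hD, ← Matrix.mul_assoc, ih, Matrix.mul_assoc,
        pow_succ]
  have : degMatrix U ^ k = M * degMatrix G ^ k * M⁻¹ := by
    rw [← h, Matrix.mul_nonsing_inv_cancel_right _ _ hM]
  have htr := congrArg Matrix.trace this
  rw [Matrix.trace_mul_comm, Matrix.nonsing_inv_mul_cancel_left _ _ hM, degMatrix, degMatrix,
    Matrix.diagonal_pow, Matrix.diagonal_pow, Matrix.trace_diagonal, Matrix.trace_diagonal] at htr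
  simp only [Pi.pow_apply] at htr
  exact_mod_cast htr

end Similarity

/-- The vertices `x` and `y` are leaves whose neighbours have degree `a` and are joined by a walk
of length `k`. -/
def LeafWalk {V : Type*} [Fintype V] (H : SimpleGraph V) (a k : ℕ) (x y : V) : Prop :=
  H.degree x = 1 ∧ ∃ p, H.Adj x p ∧ H.degree p = a ∧
    ∃ q, (∃ w : H.Walk p q, w.length = k) ∧ H.degree q = a ∧ H.Adj q y ∧ H.degree y = 1

theorem exists_iso_of_pendant_edge {V : Type*} [Fintype V] {U G : SimpleGraph V}
    (hU : U.Connected) (hG : G.Connected)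
    (hsG : ∑ v, G.degree v = 2 * Fintype.card V)
    (hq : ∑ v, U.degree v ^ 2 = ∑ v, G.degree v ^ 2) {l p l' p' : V}
    (hl : IsLeafAt U l p) (hl' : IsLeafAt G l' p') (hp : U.degree p = G.degree p')
    (h2 : ∀ v, (deleteVertex U l).degree v = 2) : Nonempty (U ≃g G) := by
  have hc := card_deleteVertex l
  have hc' := card_deleteVertex l'
  have h2' : ∀ v, (deleteVertex G l').degree v = 2 := by
    apply two_regular_of_sum
    · have := hl'.sum_degree
      omega
    · have e := hl.sum_degree_sq
      have e' := hl'.sum_degree_sq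
      simp only [h2, Finset.sum_const, Finset.card_univ, smul_eq_mul] at e
      omega
  obtain ⟨φ, hφ, -⟩ := exists_iso_of_two_regular (deleteVertex U l) (deleteVertex G l')
    (hl.connected hU) (hl'.connected hG) h2 h2' (by omega) (p := ⟨p, hl.ne⟩) (q := ⟨p, hl.ne⟩)
    (p' := ⟨p', hl'.ne⟩) (q' := ⟨p', hl'.ne⟩) (by simp)
  obtain ⟨ψ, -⟩ := hl.exists_iso hl' φ hφ
  exact ⟨ψ⟩

theorem two_regular_deleteVertex_deleteVertex {V : Type*} [Fintype V] {U G : SimpleGraph V}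
    (hsG : ∑ v, G.degree v = 2 * Fintype.card V)
    (hq : ∑ v, U.degree v ^ 2 = ∑ v, G.degree v ^ 2) {l p l' p' : V}
    (hl : IsLeafAt U l p) (hl' : IsLeafAt G l' p')
    {m q : {x // x ≠ l}} {m' q' : {x // x ≠ l'}}
    (hm : IsLeafAt (deleteVertex U l) m q) (hm' : IsLeafAt (deleteVertex G l') m' q')
    (hp : U.degree p = G.degree p')
    (hqd : (deleteVertex U l).degree q = (deleteVertex G l').degree q')
    (h2 : ∀ v, (deleteVertex (deleteVertex U l) m).degree v = 2) :
    ∀ v, (deleteVertex (deleteVertex G l') m').degree v = 2 := by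
  have hc := card_deleteVertex l
  have hc' := card_deleteVertex l'
  have hd := card_deleteVertex m
  have hd' := card_deleteVertex m'
  apply two_regular_of_sum
  · have := hl'.sum_degree
    have := hm'.sum_degree
    omega
  · have e := hl.sum_degree_sq
    have e' := hl'.sum_degree_sq
    have f := hm.sum_degree_sq
    have f' := hm'.sum_degree_sq
    simp only [h2, Finset.sum_const, Finset.card_univ, smul_eq_mul] at f
    omega

theorem exists_iso_of_pendant_path {V : Type*} [Fintype V] {U G : SimpleGraph V}
    (hU : U.Connected) (hG : G.Connected)
    (hsG : ∑ v, G.degree v = 2 * Fintype.card V)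
    (hq : ∑ v, U.degree v ^ 2 = ∑ v, G.degree v ^ 2)
    (hpath : (∃ x z, x ≠ z ∧ U.degree x = 1 ∧
        ∃ y, U.Adj x y ∧ U.degree y = 2 ∧ U.Adj y z ∧ U.degree z = 3) →
      ∃ x z, x ≠ z ∧ G.degree x = 1 ∧
        ∃ y, G.Adj x y ∧ G.degree y = 2 ∧ G.Adj y z ∧ G.degree z = 3)
    {l p : V} (hl : IsLeafAt U l p) {q : {x // x ≠ l}}
    (hm : IsLeafAt (deleteVertex U l) ⟨p, hl.ne⟩ q)
    (h2 : ∀ v, (deleteVertex (deleteVertex U l) ⟨p, hl.ne⟩).degree v = 2) :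
    Nonempty (U ≃g G) := by
  have hqp : q.1 ≠ p := fun h => hm.ne (Subtype.ext h)
  have hpU : U.degree p = 2 := by
    have := hl.degree_deleteVertex ⟨p, hl.ne⟩
    rwa [hm.degree_eq_one, if_pos rfl] at this
  have hqU' : (deleteVertex U l).degree q = 3 := by
    have := hm.degree_deleteVertex ⟨q, hm.ne⟩
    rwa [h2, if_pos rfl] at this
  have hqU : U.degree q.1 = 3 := by
    have := hl.degree_deleteVertex q
    rwa [hqU', if_neg hqp] at this
  obtain ⟨x, z, hxz, hx, y, hxy, hy, hyz, hz⟩ :=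
    hpath ⟨l, q, q.2.symm, hl.degree_eq_one, p, (hl p).2 rfl, hpU, (hm q).2 rfl, hqU⟩
  have hl' : IsLeafAt G x y := isLeafAt_of_degree_eq_one hx hxy
  have hm' : IsLeafAt (deleteVertex G x) ⟨y, hl'.ne⟩ ⟨z, hxz.symm⟩ := by
    apply isLeafAt_of_degree_eq_one (H := deleteVertex G x)
      (l := ⟨y, hl'.ne⟩) (p := ⟨z, hxz.symm⟩) _ hyz
    have := hl'.degree_deleteVertex ⟨y, hl'.ne⟩
    rw [if_pos rfl] at this
    simp only at this
    omega
  have hz' : (deleteVertex G x).degree ⟨z, hxz.symm⟩ = 3 := by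
    have := hl'.degree_deleteVertex ⟨z, hxz.symm⟩
    rw [if_neg (show z ≠ y from hyz.ne')] at this
    simp only at this
    omega
  have h2' := two_regular_deleteVertex_deleteVertex hsG hq hl hl' hm hm' (hpU.trans hy.symm)
    (hqU'.trans hz'.symm) h2
  have hc := card_deleteVertex l
  have hc' := card_deleteVertex x
  have hd := card_deleteVertex (⟨p, hl.ne⟩ : {x // x ≠ l})
  have hd' := card_deleteVertex (⟨y, hl'.ne⟩ : {v // v ≠ x})
  obtain ⟨φ, hφ, -⟩ := exists_iso_of_two_regular _ _
    (hm.connected (hl.connected hU)) (hm'.connected (hl'.connected hG)) h2 h2' (by omega)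
    (p := ⟨q, hm.ne⟩) (q := ⟨q, hm.ne⟩) (p' := ⟨_, hm'.ne⟩) (q' := ⟨_, hm'.ne⟩) (by simp)
  obtain ⟨χ, hχ, -⟩ := hm.exists_iso hm' φ hφ
  obtain ⟨ψ, -⟩ := hl.exists_iso hl' χ hχ
  exact ⟨ψ⟩

theorem exists_iso_of_two_leaves {V : Type*} [Fintype V] {U G : SimpleGraph V}
    (hU : U.Connected) (hG : G.Connected)
    (hsG : ∑ v, G.degree v = 2 * Fintype.card V)
    (hq : ∑ v, U.degree v ^ 2 = ∑ v, G.degree v ^ 2)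
    (hwalk : ∀ a k, (∃ x y, x ≠ y ∧ LeafWalk U a k x y) ↔ ∃ x y, x ≠ y ∧ LeafWalk G a k x y)
    {l p : V} (hl : IsLeafAt U l p) {m q : {x // x ≠ l}}
    (hm : IsLeafAt (deleteVertex U l) m q) (hpm : p ≠ m)
    (h2 : ∀ v, (deleteVertex (deleteVertex U l) m).degree v = 2) :
    Nonempty (U ≃g G) := by
  have hml : IsLeafAt U m q := by
    apply isLeafAt_of_degree_eq_one (H := U) _ ((hm q).2 rfl)
    rw [hl.degree_deleteVertex, hm.degree_eq_one, if_neg hpm.symm]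
  have hpq : U.degree q = U.degree p := by
    by_cases h : p = q
    · rw [h]
    have e1 := hl.degree_deleteVertex ⟨p, hl.ne⟩
    have e2 := hm.degree_deleteVertex ⟨⟨p, hl.ne⟩, fun e => hpm (congrArg Subtype.val e)⟩
    have e3 := hl.degree_deleteVertex q
    have e4 := hm.degree_deleteVertex ⟨q, hm.ne⟩
    rw [if_pos rfl] at e1 e4
    rw [h2, if_neg fun e => h (congrArg Subtype.val e)] at e2
    rw [h2] at e4
    rw [if_neg (Ne.symm h)] at e3
    simp only at e1 e2 e3 e4
    omega
  have hleaves : ∀ v, U.degree v = 1 → v = l ∨ v = m := by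
    intro v hv
    by_contra! hcon
    have e1 := hl.degree_deleteVertex ⟨v, hcon.1⟩
    have e2 := hm.degree_deleteVertex ⟨⟨v, hcon.1⟩, fun e => hcon.2 (congrArg Subtype.val e)⟩
    rw [h2] at e2
    simp only at e1 e2
    omega
  have hmin : ∀ {x y : V} {k : ℕ}, x ≠ y → LeafWalk U (U.degree p) k x y → U.dist p q ≤ k := by
    rintro x y k hxy ⟨hx, p₁, hxp, -, q₁, ⟨w, rfl⟩, -, hqy, hy⟩
    rcases hleaves x hx with rfl | rfl <;> rcases hleaves y hy with rfl | rfl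
    · exact absurd rfl hxy
    · obtain rfl := (hl p₁).1 hxp
      obtain rfl := (hml q₁).1 hqy.symm
      exact SimpleGraph.dist_le w
    · obtain rfl := (hml p₁).1 hxp
      obtain rfl := (hl q₁).1 hqy.symm
      rw [SimpleGraph.dist_comm]
      exact SimpleGraph.dist_le w
    · exact absurd rfl hxy
  obtain ⟨x, y, hxy, hLW⟩ := (hwalk (U.degree p) (U.dist p q)).1 ⟨l, m, m.2.symm,
    hl.degree_eq_one, p, (hl p).2 rfl, rfl, q, hU.exists_walk_length_eq_dist p q, hpq,
    ((hml q).2 rfl).symm, hml.degree_eq_one⟩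
  obtain ⟨hx, p', hxp, hp', q', ⟨w, hw⟩, hq', hqy, hy⟩ := hLW
  have hdist : U.dist p q = G.dist p' q' := by
    apply le_antisymm
    · obtain ⟨u, v, huv, h⟩ := (hwalk (U.degree p) (G.dist p' q')).2 ⟨x, y, hxy, hx, p', hxp, hp', q',
        hG.exists_walk_length_eq_dist p' q', hq', hqy, hy⟩
      exact hmin huv h
    · rw [← hw]
      exact SimpleGraph.dist_le w
  have hpq_iff : p = q ↔ p' = q' := by
    rw [← hU.dist_eq_zero_iff, ← hG.dist_eq_zero_iff, hdist]
  have hl' : IsLeafAt G x p' := isLeafAt_of_degree_eq_one hx hxp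
  have hp'y : p' ≠ y := by
    rintro rfl
    have hp1 : U.degree p = 1 := hp'.symm.trans hy
    rcases hleaves p hp1 with h | h
    · exact hl.ne h
    · exact hpm h
  have hq'x : q' ≠ x := by
    rintro rfl
    have hp1 : U.degree p = 1 := hq'.symm.trans hx
    rcases hleaves p hp1 with h | h
    · exact hl.ne h
    · exact hpm h
  have hm' : IsLeafAt (deleteVertex G x) ⟨y, hxy.symm⟩ ⟨q', hq'x⟩ := by
    apply isLeafAt_of_degree_eq_one (H := deleteVertex G x)
      (l := ⟨y, hxy.symm⟩) (p := ⟨q', hq'x⟩) _ hqy.symm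
    have := hl'.degree_deleteVertex ⟨y, hxy.symm⟩
    rw [if_neg (show y ≠ p' from hp'y.symm)] at this
    simp only at this
    omega
  have hqd : (deleteVertex U l).degree q = (deleteVertex G x).degree ⟨q', hq'x⟩ := by
    have e1 := hl.degree_deleteVertex q
    have e2 := hl'.degree_deleteVertex ⟨q', hq'x⟩
    have e3 : (q.1 = p) ↔ (q' = p') := by rw [eq_comm, hpq_iff, eq_comm]
    simp only [e3] at e1 e2
    omega
  have h2' := two_regular_deleteVertex_deleteVertex hsG hq hl hl' hm hm' hp'.symm hqd h2
  have hc := card_deleteVertex l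
  have hc' := card_deleteVertex x
  have hd := card_deleteVertex m
  have hd' := card_deleteVertex (⟨y, hxy.symm⟩ : {v // v ≠ x})
  have hpm' : (⟨p, hl.ne⟩ : {x // x ≠ l}) ≠ m := fun e => hpm (congrArg Subtype.val e)
  have hpy' : (⟨p', hl'.ne⟩ : {v // v ≠ x}) ≠ ⟨y, hxy.symm⟩ :=
    fun e => hp'y (congrArg Subtype.val e)
  obtain ⟨φ, hφp, hφq⟩ := exists_iso_of_two_regular _ _
    (hm.connected (hl.connected hU)) (hm'.connected (hl'.connected hG)) h2 h2' (by omega)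
    (p := ⟨⟨p, hl.ne⟩, hpm'⟩) (q := ⟨q, hm.ne⟩) (p' := ⟨⟨p', hl'.ne⟩, hpy'⟩)
    (q' := ⟨⟨q', hq'x⟩, hm'.ne⟩) (by
      rw [hm.dist_deleteVertex (hl.connected hU), hl.dist_deleteVertex hU,
        hm'.dist_deleteVertex (hl'.connected hG), hl'.dist_deleteVertex hG]
      exact hdist)
  obtain ⟨χ, -, hχ⟩ := hm.exists_iso hm' φ hφq
  have hχp : χ ⟨p, hl.ne⟩ = ⟨p', hl'.ne⟩ := by
    rw [hχ _ hpm', hφp]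
  obtain ⟨ψ, -, -⟩ := hl.exists_iso hl' χ hχp
  exact ⟨ψ⟩

/-- A unicyclic graph on `n` vertices whose girth is at least `n - 2` is
degree-similar determined. -/
theorem stmt11 {V : Type*} [Fintype V] [DecidableEq V]
    (U : SimpleGraph V) (hU : Unicyclic U)
    (hg : ((Fintype.card V - 2 : ℕ) : ℕ∞) ≤ U.girth) :
    ∀ G : SimpleGraph V, DegreeSimilar U G → Nonempty (U ≃g G) := by
  rintro G ⟨M, hM, hA, hD⟩
  obtain ⟨hUc, hUe⟩ := hU
  have hg' : Fintype.card V - 2 ≤ U.girth := by exact_mod_cast hg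
  have hA' : U.adjMatrix ℝ * M = M * G.adjMatrix ℝ := by
    rw [← hA, Matrix.mul_assoc, Matrix.mul_nonsing_inv_cancel_left _ _ hM]
  have hD' : degMatrix U * M = M * degMatrix G := by
    rw [← hD, Matrix.mul_assoc, Matrix.mul_nonsing_inv_cancel_left _ _ hM]
  have hL : U.lapMatrix ℝ * M = M * G.lapMatrix ℝ := by
    change (degMatrix U - U.adjMatrix ℝ) * M = M * (degMatrix G - G.adjMatrix ℝ)
    rw [Matrix.sub_mul, Matrix.mul_sub, hA', hD']
  have hGc := connected_of_lapMatrix_similar hM hL hUc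
  obtain ⟨c, hc, h1, h2⟩ := exists_eigenvalue_of_lapMatrix_similar hM hL hUc hGc
  have hsU : ∑ v, U.degree v = 2 * Fintype.card V := by
    rw [← hUe]
    convert U.sum_degrees_eq_twice_card_edges
  have hsG : ∑ v, G.degree v = 2 * Fintype.card V := by
    rw [← hsU]
    simpa using (sum_degree_pow_eq hM hD' 1).symm
  have hq := sum_degree_pow_eq hM hD' 2
  have hedge : ∀ a, (∃ x z, x ≠ z ∧ U.degree x = 1 ∧ U.Adj x z ∧ U.degree z = a) ↔
      ∃ x z, x ≠ z ∧ G.degree x = 1 ∧ G.Adj x z ∧ G.degree z = a := fun a =>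
    (((linked_adj hA').mul_degree hD' a).degree_mul hD' 1).exists_ne_iff hM hc h1 h2
  have hpath : (∃ x z, x ≠ z ∧ U.degree x = 1 ∧
        ∃ y, U.Adj x y ∧ U.degree y = 2 ∧ U.Adj y z ∧ U.degree z = 3) ↔
      ∃ x z, x ≠ z ∧ G.degree x = 1 ∧
        ∃ y, G.Adj x y ∧ G.degree y = 2 ∧ G.Adj y z ∧ G.degree z = 3 :=
    (((linked_adj hA').comp (((linked_adj hA').mul_degree hD' 3).degree_mul hD' 2)).degree_mul
      hD' 1).exists_ne_iff hM hc h1 h2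
  have hwalk : ∀ a k, (∃ x y, x ≠ y ∧ LeafWalk U a k x y) ↔ ∃ x y, x ≠ y ∧ LeafWalk G a k x y :=
    fun a k => (((linked_adj hA').comp (((linked_walk hA' k).comp
      (((linked_adj hA').mul_degree hD' 1).degree_mul hD' a)).degree_mul hD' a)).degree_mul
      hD' 1).exists_ne_iff hM hc h1 h2
  by_cases h0 : ∀ v, U.degree v = 2
  · have h0' : ∀ v, G.degree v = 2 := two_regular_of_sum hsG (by
      rw [← hq]
      simp [h0, mul_comm])
    obtain ⟨a⟩ := hUc.nonempty
    obtain ⟨φ, -⟩ := exists_iso_of_two_regular U G hUc hGc h0 h0' rfl (p := a) (q := a) (p' := a)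
      (q' := a) (by simp)
    exact ⟨φ⟩
  obtain ⟨l, p, hl⟩ := exists_isLeafAt hUc hsU h0
  have hcl := card_deleteVertex l
  have hsl := hl.sum_degree
  have hlc := hl.connected hUc
  by_cases h3 : ∀ v, (deleteVertex U l).degree v = 2
  · obtain ⟨l', p', -, hl', hlp', hp'⟩ := (hedge (U.degree p)).1
      ⟨l, p, hl.ne.symm, hl.degree_eq_one, (hl p).2 rfl, rfl⟩
    exact exists_iso_of_pendant_edge hUc hGc hsG hq hl (isLeafAt_of_degree_eq_one hl' hlp')
      hp'.symm h3
  obtain ⟨m, q, hm⟩ := exists_isLeafAt hlc (by omega) h3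
  have hcm := card_deleteVertex m
  have hsm := hm.sum_degree
  have hmc := hm.connected hlc
  have h4 : ∀ v, (deleteVertex (deleteVertex U l) m).degree v = 2 := by
    by_contra h4
    obtain ⟨r, s, hr⟩ := exists_isLeafAt hmc (by omega) h4
    have hcr := card_deleteVertex r
    have hsr := hr.sum_degree
    have hrc := hr.connected hmc
    have := girth_le_card_of_embedding hrc (by omega)
      ((deleteVertexEmbedding _ r).trans ((deleteVertexEmbedding _ m).trans
        (deleteVertexEmbedding U l)))
    omega
  by_cases hpm : p = m
  · obtain ⟨m, hml⟩ := m
    subst hpm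
    exact exists_iso_of_pendant_path hUc hGc hsG hq hpath.1 hl hm h4
  · exact exists_iso_of_two_leaves hUc hGc hsG hq hwalk hl hm hpm h4
end

section
/- Let U be a unicyclic graph with unique cycle C, and suppose there is a vertex r on C such that: every vertex of C other than r has degree exactly 2 in U; deg_U(r) ≥ 5; and every vertex of U not on C has degree different from 2 and degree strictly less than deg_U(r) − 2. (Equivalently, U is the coalescence C_g(r) ⊙ T(v) of a cycle C_g rooted at r with a tree T rooted at v, where T contains no vertices of degree 2 and v is the unique vertex of T with maximum degree.) Then U is degree-similar determined: every graph on the same vertex set that is degree-similar to U is isomorphic to U. -/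
open scoped Classical

section DegreeSimilarity

open SimpleGraph Matrix

section LinearAlgebra

variable {V : Type*} [Fintype V] [DecidableEq V]

/-- `M` only relates indices carrying the same label. -/
def RespectsLabels {V α : Type*} (M : Matrix V V ℝ) (f h : V → α) : Prop :=
  ∀ x y, M x y ≠ 0 → f x = h y

lemma RespectsLabels.comp {V α β : Type*} {M : Matrix V V ℝ} {f h : V → α}
    (H : RespectsLabels M f h) (g : α → β) :
    RespectsLabels M (fun x => g (f x)) (fun x => g (h x)) :=
  fun x y hxy => congrArg g (H x y hxy)

lemma RespectsLabels.prodMk {V α β : Type*} {M : Matrix V V ℝ} {f h : V → α} {f' h' : V → β}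
    (H : RespectsLabels M f h) (H' : RespectsLabels M f' h') :
    RespectsLabels M (fun x => (f x, f' x)) (fun x => (h x, h' x)) :=
  fun x y hxy => Prod.ext (H x y hxy) (H' x y hxy)

lemma diagonal_mul_eq_mul_diagonal_iff {M : Matrix V V ℝ} {f h : V → ℝ} :
    diagonal f * M = M * diagonal h ↔ RespectsLabels M f h := by
  simp only [← Matrix.ext_iff, diagonal_mul, mul_diagonal, RespectsLabels]
  refine forall₂_congr fun x y => ?_
  rw [mul_comm, mul_eq_mul_left_iff]
  tauto

lemma exists_perm_apply_ne_zero {M : Matrix V V ℝ} (hM : M.det ≠ 0) :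
    ∃ σ : Equiv.Perm V, ∀ y, M (σ y) y ≠ 0 := by
  by_contra! hcon
  refine hM ?_
  rw [det_apply]
  refine Finset.sum_eq_zero fun σ _ => ?_
  obtain ⟨y, hy⟩ := hcon σ
  have h0 : ∏ i, M (σ i) i = 0 := Finset.prod_eq_zero (Finset.mem_univ y) hy
  exact (congrArg _ h0).trans (smul_zero _)

end LinearAlgebra

section Pruning

variable {V : Type*} [Fintype V]

/-- The number of leaves adjacent to `x` that satisfy `q`. -/
noncomputable def leafCount (G : SimpleGraph V) (q : V → Prop) (x : V) : ℕ :=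
  Finset.card {y | G.Adj x y ∧ G.degree y = 1 ∧ q y}

/-- The graph obtained by deleting all edges at leaves. -/
def prune (G : SimpleGraph V) : SimpleGraph V where
  Adj x y := G.Adj x y ∧ G.degree x ≠ 1 ∧ G.degree y ≠ 1
  symm := ⟨fun _ _ h => ⟨h.1.symm, h.2.2, h.2.1⟩⟩
  loopless := ⟨fun _ h => h.1.ne rfl⟩

lemma prune_adj {G : SimpleGraph V} {x y : V} :
    (prune G).Adj x y ↔ G.Adj x y ∧ G.degree x ≠ 1 ∧ G.degree y ≠ 1 := Iff.rfl

lemma eq_of_adj_of_degree_eq_one {G : SimpleGraph V} {x y z : V} (hx : G.degree x = 1)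
    (hy : G.Adj x y) (hz : G.Adj x z) : y = z :=
  (degree_eq_one_iff_existsUnique_adj.mp hx).unique hy hz

lemma degree_prune_of_eq_one {G : SimpleGraph V} {x : V} (hx : G.degree x = 1) :
    (prune G).degree x = 0 := by
  rw [degree_eq_zero]
  intro y hy
  exact hy.2.1 hx

lemma degree_prune_of_ne_one {G : SimpleGraph V} {x : V} (hx : G.degree x ≠ 1) :
    (prune G).degree x = G.degree x - leafCount G (fun _ => True) x := by
  have h := Finset.card_filter_add_card_filter_not (s := G.neighborFinset x)
    (fun y => G.degree y = 1)
  rw [card_neighborFinset_eq_degree] at h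
  rw [← h, ← card_neighborFinset_eq_degree]
  have h1 : ((G.neighborFinset x).filter fun y => G.degree y = 1).card
      = leafCount G (fun _ => True) x := by
    unfold leafCount
    congr 1
    ext
    simp
  have h2 : (G.neighborFinset x).filter (fun y => ¬ G.degree y = 1)
      = (prune G).neighborFinset x := by ext; simp [prune_adj, hx]
  rw [h1, h2]
  exact (Nat.add_sub_cancel_left ..).symm

variable [DecidableEq V]

lemma adjMatrix_mul_diagonal_mul_adjMatrix (G : SimpleGraph V) (q : V → Prop) :
    G.adjMatrix ℝ * diagonal (fun y => if G.degree y = 1 ∧ q y then (1 : ℝ) else 0)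
      * G.adjMatrix ℝ = diagonal fun x => (leafCount G q x : ℝ) := by
  ext x z
  rw [mul_apply]
  simp only [mul_diagonal, adjMatrix_apply, diagonal_apply]
  split_ifs with hxz
  · subst hxz
    rw [leafCount, Finset.card_filter, Nat.cast_sum]
    refine Finset.sum_congr rfl fun y _ => ?_
    by_cases h : G.Adj x y <;> by_cases h' : G.degree y = 1 ∧ q y <;> simp [h, h', G.adj_comm y x]
  · refine Finset.sum_eq_zero fun y _ => ?_
    by_contra hne
    simp only [mul_ite, mul_one, mul_zero, ite_eq_right_iff, not_forall] at hne
    obtain ⟨h1, h2, h3, -⟩ := hne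
    exact hxz (eq_of_adj_of_degree_eq_one h2.1 h3.symm h1)

lemma adjMatrix_prune (G : SimpleGraph V) :
    (prune G).adjMatrix ℝ = diagonal (fun x => if G.degree x = 1 then (0 : ℝ) else 1)
      * G.adjMatrix ℝ * diagonal (fun x => if G.degree x = 1 then (0 : ℝ) else 1) := by
  ext x y
  simp only [mul_diagonal, diagonal_mul, adjMatrix_apply, prune_adj]
  by_cases h1 : G.degree x = 1 <;> by_cases h2 : G.degree y = 1 <;> by_cases h : G.Adj x y <;>
    simp [h1, h2, h]

variable {G H : SimpleGraph V} {M : Matrix V V ℝ}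

lemma RespectsLabels.leafCount (hA : G.adjMatrix ℝ * M = M * H.adjMatrix ℝ)
    (hd : RespectsLabels M (fun x => G.degree x) (fun x => H.degree x)) {q q' : V → Prop}
    (hq : RespectsLabels M q q') :
    RespectsLabels M (leafCount G q) (leafCount H q') := by
  have hP := diagonal_mul_eq_mul_diagonal_iff.mpr
    ((hd.prodMk hq).comp fun t => if t.1 = 1 ∧ t.2 then (1 : ℝ) else 0)
  have key : diagonal (fun x => (_root_.leafCount G q x : ℝ)) * M
      = M * diagonal fun x => (_root_.leafCount H q' x : ℝ) := by
    rw [← adjMatrix_mul_diagonal_mul_adjMatrix, ← adjMatrix_mul_diagonal_mul_adjMatrix,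
      Matrix.mul_assoc, hA, Matrix.mul_assoc, ← Matrix.mul_assoc _ M, hP, ← Matrix.mul_assoc,
      ← Matrix.mul_assoc, hA]
    simp only [Matrix.mul_assoc]
  exact fun x y hxy => Nat.cast_injective (diagonal_mul_eq_mul_diagonal_iff.mp key x y hxy)

lemma adjMatrix_prune_mul (hA : G.adjMatrix ℝ * M = M * H.adjMatrix ℝ)
    (hd : RespectsLabels M (fun x => G.degree x) (fun x => H.degree x)) :
    (prune G).adjMatrix ℝ * M = M * (prune H).adjMatrix ℝ := by
  have hP := diagonal_mul_eq_mul_diagonal_iff.mpr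
    (hd.comp fun t => if t = 1 then (0 : ℝ) else 1)
  rw [adjMatrix_prune, adjMatrix_prune, Matrix.mul_assoc, hP, Matrix.mul_assoc,
    ← Matrix.mul_assoc _ M, hA, ← Matrix.mul_assoc, ← Matrix.mul_assoc, hP]
  simp only [Matrix.mul_assoc]

lemma RespectsLabels.degree_prune (hA : G.adjMatrix ℝ * M = M * H.adjMatrix ℝ)
    (hd : RespectsLabels M (fun x => G.degree x) (fun x => H.degree x)) :
    RespectsLabels M (fun x => (prune G).degree x) (fun x => (prune H).degree x) := by
  intro x y hxy
  have h1 : G.degree x = H.degree y := hd x y hxy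
  have h2 := RespectsLabels.leafCount hA hd (q := fun _ => True) (q' := fun _ => True)
    (fun _ _ _ => rfl) x y hxy
  by_cases h : G.degree x = 1
  · simp only [degree_prune_of_eq_one h, degree_prune_of_eq_one (h1 ▸ h)]
  · simp only [degree_prune_of_ne_one h, degree_prune_of_ne_one (h1 ▸ h), h1, h2]

end Pruning

section Reconstruction

variable {V : Type*} [Fintype V]

lemma card_edgeFinset_eq_of_degree_perm {G H : SimpleGraph V} (σ : Equiv.Perm V)
    (hσ : ∀ y, G.degree (σ y) = H.degree y) : G.edgeFinset.card = H.edgeFinset.card := by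
  have h : ∑ x, G.degree x = ∑ x, H.degree x := by
    rw [← Equiv.sum_comp σ]
    exact Finset.sum_congr rfl fun y _ => hσ y
  rw [sum_degrees_eq_twice_card_edges, sum_degrees_eq_twice_card_edges] at h
  omega

/-- A bijective homomorphism between finite graphs with equally many edges is an isomorphism. -/
lemma adj_iff_of_perm_hom {G H : SimpleGraph V} (ψ : Equiv.Perm V)
    (hψ : ∀ x y, G.Adj x y → H.Adj (ψ x) (ψ y))
    (hcard : G.edgeFinset.card = H.edgeFinset.card) {x y : V} :
    H.Adj (ψ x) (ψ y) ↔ G.Adj x y := by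
  have hle : G ≤ H.comap ψ := fun a b hab => hψ a b hab
  have heq : G.edgeFinset = (H.comap ψ).edgeFinset :=
    Finset.eq_of_subset_of_card_le (edgeFinset_subset_edgeFinset.mpr hle)
      (by rw [hcard, (Iso.comap ψ H).card_edgeFinset_eq])
  rw [edgeFinset_inj.mp heq, comap_adj]

lemma exists_equiv_of_card_fiber_eq {X Y K : Type*} [Finite X] [Finite Y] (κ : X → K) (μ : Y → K)
    (hcard : ∀ k, Nat.card {x // κ x = k} = Nat.card {y // μ y = k}) :
    ∃ e : X ≃ Y, ∀ x, μ (e x) = κ x := by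
  let E := fun k => Classical.choice (Finite.card_eq.mp (hcard k))
  let e := (Equiv.sigmaFiberEquiv κ).symm.trans
    ((Equiv.sigmaCongrRight E).trans (Equiv.sigmaFiberEquiv μ))
  exact ⟨e, fun x => (E (κ x) ⟨x, rfl⟩).2⟩

lemma card_leaf_fiber {G : SimpleGraph V} {α : Type*} {p : {x // G.degree x = 1} → V}
    (hp : ∀ y : {x // G.degree x = 1}, G.Adj y (p y)) (f : V → α) (φ : Equiv.Perm V) (v : V)
    (a : α) :
    Nat.card {y : {x // G.degree x = 1} // (φ (p y), f y) = (φ v, a)}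
      = leafCount G (fun y => f y = a) v := by
  unfold leafCount
  rw [← Fintype.card_coe, ← Nat.card_eq_fintype_card]
  refine Nat.card_congr ⟨fun y => ⟨y.1.1, ?_⟩, fun y => ⟨⟨y.1, ?_⟩, ?_⟩,
    fun y => rfl, fun y => rfl⟩
  · obtain ⟨⟨y, hy⟩, hk⟩ := y
    obtain ⟨h1, rfl⟩ := Prod.mk.inj hk
    simpa [hy, ← φ.injective h1] using (hp ⟨y, hy⟩).symm
  · exact (Finset.mem_filter.mp y.2).2.2.1
  · obtain ⟨-, h1, h2, h3⟩ := Finset.mem_filter.mp y.2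
    simp [eq_of_adj_of_degree_eq_one h2 (hp ⟨y.1, h2⟩) h1.symm, h3]

/-- An isomorphism of pruned graphs that preserves labels, leaves and the number of leaves of each
label at every vertex can be corrected on the leaves to a label-preserving isomorphism. -/
lemma exists_iso_of_iso_prune {G H : SimpleGraph V} {α : Type*} {f h : V → α}
    (hcard : G.edgeFinset.card = H.edgeFinset.card)
    (hleaf : ∀ x y, G.degree x = 1 → G.Adj x y → G.degree y ≠ 1)
    (φ : prune G ≃g prune H) (hlabel : ∀ x, h (φ x) = f x)
    (hdeg : ∀ x, H.degree (φ x) = 1 ↔ G.degree x = 1)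
    (hcount : ∀ x a, leafCount H (fun y => h y = a) (φ x) = leafCount G (fun y => f y = a) x) :
    ∃ ψ : G ≃g H, ∀ x, h (ψ x) = f x := by
  have hexG : ∀ y : {x // G.degree x = 1}, ∃ z, G.Adj y z := fun y =>
    (degree_eq_one_iff_existsUnique_adj.mp y.2).exists
  have hexH : ∀ y : {x // H.degree x = 1}, ∃ z, H.Adj y z := fun y =>
    (degree_eq_one_iff_existsUnique_adj.mp y.2).exists
  choose pG hpG using hexG
  choose pH hpH using hexH
  obtain ⟨e, he⟩ := exists_equiv_of_card_fiber_eq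
    (fun y : {x // G.degree x = 1} => (φ (pG y), f y))
    (fun y : {x // H.degree x = 1} => (pH y, h y)) (by
      rintro ⟨v, a⟩
      obtain ⟨u, rfl⟩ := φ.surjective v
      exact (card_leaf_fiber hpG f φ.toEquiv u a).trans
        ((hcount u a).symm.trans (card_leaf_fiber hpH h (Equiv.refl V) (φ u) a).symm))
  let ψ : Equiv.Perm V := Equiv.subtypeCongr e
    (φ.toEquiv.subtypeEquiv fun x => (not_congr (hdeg x)).symm)
  have hψ1 : ∀ y : {x // G.degree x = 1}, ψ y = e y := fun y => by
    simp [ψ, Equiv.subtypeCongr]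
  have hψ2 : ∀ x, G.degree x ≠ 1 → ψ x = φ x := fun x hx => by
    simp only [ψ, Equiv.subtypeCongr, Equiv.trans_apply]
    rw [Equiv.sumCompl_symm_apply_of_neg (p := fun x => G.degree x = 1) hx]
    rfl
  have hmixed : ∀ x y, G.degree x = 1 → G.Adj x y → H.Adj (ψ x) (ψ y) := by
    intro x y hx hxy
    rw [hψ1 ⟨x, hx⟩, hψ2 y (hleaf x y hx hxy),
      eq_of_adj_of_degree_eq_one hx hxy (hpG ⟨x, hx⟩), ← (Prod.mk.inj (he ⟨x, hx⟩)).1]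
    exact hpH _
  have hhom : ∀ x y, G.Adj x y → H.Adj (ψ x) (ψ y) := by
    intro x y hxy
    by_cases hx : G.degree x = 1
    · exact hmixed x y hx hxy
    by_cases hy : G.degree y = 1
    · exact (hmixed y x hy hxy.symm).symm
    rw [hψ2 x hx, hψ2 y hy]
    exact (φ.map_adj_iff.mpr (prune_adj.mpr ⟨hxy, hx, hy⟩)).1
  refine ⟨⟨ψ, adj_iff_of_perm_hom ψ hhom hcard⟩, fun x => ?_⟩
  change h (ψ x) = f x
  by_cases hx : G.degree x = 1
  · rw [hψ1 ⟨x, hx⟩]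
    exact (Prod.mk.inj (he ⟨x, hx⟩)).2
  · rw [hψ2 x hx, hlabel]

end Reconstruction

section Unicyclic

variable {V : Type*} {n : ℕ}

/-- `p` traverses a cycle of `G` whose vertices other than `p 0` have no further neighbours, and
off this cycle `d` turns the nontrivial components of the rest of `G` into forests rooted at the
cycle: a vertex with a neighbour has exactly one neighbour that is not of larger depth `d`, and that
neighbour has smaller depth. -/
structure IsRootedCycle (G : SimpleGraph V) (p : ZMod n → V) (d : V → ℕ) : Prop where
  injective : Function.Injective p
  adj (i : ZMod n) : G.Adj (p i) (p (i + 1))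
  eq_or_eq (i : ZMod n) (hi : i ≠ 0) (y : V) (h : G.Adj (p i) y) : y = p (i + 1) ∨ y = p (i - 1)
  depth_root : d (p 0) = 0
  exists_parent (x : V) (hx : x ∉ Set.range p) (h : ∃ y, G.Adj x y) : ∃ y, G.Adj x y ∧ d y < d x
  parent_unique (x : V) (hx : x ∉ Set.range p) (y z : V) (hy : G.Adj x y) (hz : G.Adj x z)
    (hdy : d y ≤ d x) (hdz : d z ≤ d x) : y = z

lemma ZMod.add_one_ne_sub_one (hn : 3 ≤ n) (i : ZMod n) : i + 1 ≠ i - 1 := by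
  intro h
  have h2 : ((2 : ℕ) : ZMod n) = 0 := by
    push_cast
    linear_combination h
  have := Nat.le_of_dvd two_pos ((ZMod.natCast_eq_zero_iff 2 n).mp h2)
  omega

lemma ZMod.apply_eq_apply_zero {β : Type*} [NeZero n] {g : ZMod n → β}
    (hg : ∀ i, g (i + 1) = g i) (i : ZMod n) : g i = g 0 := by
  obtain ⟨k, rfl⟩ := ZMod.natCast_zmod_surjective i
  induction k with
  | zero => simp
  | succ k ih => rw [Nat.cast_succ, hg, ih]

namespace IsRootedCycle

variable {G : SimpleGraph V} {p : ZMod n → V} {d : V → ℕ}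

lemma adj_sub_one (h : IsRootedCycle G p d) (i : ZMod n) : G.Adj (p i) (p (i - 1)) := by
  simpa using (h.adj (i - 1)).symm

variable [Fintype V]

lemma degree_ne_one (h : IsRootedCycle G p d) (hn : 3 ≤ n) (i : ZMod n) : G.degree (p i) ≠ 1 :=
  fun hi => ZMod.add_one_ne_sub_one hn i
    (h.injective (eq_of_adj_of_degree_eq_one hi (h.adj i) (h.adj_sub_one i)))

lemma degree_ne_one_of_lt (h : IsRootedCycle G p d) (hn : 3 ≤ n) {x y : V} (hxy : G.Adj x y)
    (hd : d y < d x) : G.degree y ≠ 1 := by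
  intro hy
  by_cases hyp : y ∈ Set.range p
  · obtain ⟨i, rfl⟩ := hyp
    exact h.degree_ne_one hn i hy
  · obtain ⟨z, hyz, hz⟩ := h.exists_parent y hyp ⟨x, hxy.symm⟩
    rw [eq_of_adj_of_degree_eq_one hy hyz hxy.symm] at hz
    omega

lemma degree_ne_one_of_adj_leaf (h : IsRootedCycle G p d) (hn : 3 ≤ n) {x y : V}
    (hx : G.degree x = 1) (hxy : G.Adj x y) : G.degree y ≠ 1 := by
  have hxp : x ∉ Set.range p := by
    rintro ⟨i, rfl⟩
    exact h.degree_ne_one hn i hx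
  obtain ⟨z, hxz, hz⟩ := h.exists_parent x hxp ⟨y, hxy⟩
  rw [eq_of_adj_of_degree_eq_one hx hxy hxz]
  exact h.degree_ne_one_of_lt hn hxz hz

lemma prune (h : IsRootedCycle G p d) (hn : 3 ≤ n) : IsRootedCycle (prune G) p d where
  injective := h.injective
  adj i := ⟨h.adj i, h.degree_ne_one hn i, h.degree_ne_one hn (i + 1)⟩
  eq_or_eq i hi y hy := h.eq_or_eq i hi y hy.1
  depth_root := h.depth_root
  exists_parent := by
    rintro x hx ⟨y, hy⟩
    obtain ⟨z, hz, hd⟩ := h.exists_parent x hx ⟨y, hy.1⟩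
    exact ⟨z, ⟨hz, hy.2.1, h.degree_ne_one_of_lt hn hz hd⟩, hd⟩
  parent_unique x hx y z hy hz := h.parent_unique x hx y z hy.1 hz.1

lemma leafCount_eq_zero (h : IsRootedCycle G p d) (hn : 3 ≤ n) {i : ZMod n} (hi : i ≠ 0)
    (q : V → Prop) : leafCount G q (p i) = 0 := by
  rw [leafCount, Finset.card_eq_zero, Finset.filter_eq_empty_iff]
  rintro y - ⟨hy, hy1, -⟩
  obtain rfl | rfl := h.eq_or_eq i hi y hy
  · exact h.degree_ne_one hn _ hy1
  · exact h.degree_ne_one hn _ hy1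

/-- Without leaves there is nothing but the cycle. -/
lemma mem_range_of_adj (h : IsRootedCycle G p d) (hleaf : ∀ x, G.degree x ≠ 1) {x y : V}
    (hxy : G.Adj x y) : x ∈ Set.range p := by
  by_contra hx
  obtain ⟨w, hw, hmax⟩ := Finset.exists_max_image
    (Finset.univ.filter fun x => x ∉ Set.range p ∧ ∃ y, G.Adj x y) d
    ⟨x, Finset.mem_filter.mpr ⟨Finset.mem_univ x, hx, y, hxy⟩⟩
  obtain ⟨-, hwp, hwa⟩ := Finset.mem_filter.mp hw
  obtain ⟨y, hwy, hdy⟩ := h.exists_parent w hwp hwa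
  obtain ⟨z, hwz, hzy⟩ : ∃ z, G.Adj w z ∧ z ≠ y := by
    by_contra! hcon
    exact hleaf w (degree_eq_one_iff_existsUnique_adj.mpr ⟨y, hwy, hcon⟩)
  have hdz : d w < d z := by
    by_contra! hcon
    exact hzy (h.parent_unique w hwp z y hwz hwy hcon hdy.le)
  by_cases hz : z ∈ Set.range p
  · obtain ⟨i, rfl⟩ := hz
    by_cases hi : i = 0
    · rw [hi, h.depth_root] at hdz
      omega
    · obtain rfl | rfl := h.eq_or_eq i hi w hwz.symm <;> exact hwp ⟨_, rfl⟩
  · have := hmax z (Finset.mem_filter.mpr ⟨Finset.mem_univ z, hz, w, hwz.symm⟩)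
    omega

lemma eq_or_eq_of_forall_degree_ne_one (h : IsRootedCycle G p d) (hleaf : ∀ x, G.degree x ≠ 1)
    {i : ZMod n} {y : V} (hy : G.Adj (p i) y) : y = p (i + 1) ∨ y = p (i - 1) := by
  by_cases hi : i = 0
  · obtain ⟨j, rfl⟩ := h.mem_range_of_adj hleaf hy.symm
    have hj : j ≠ 0 := fun hj => hy.ne (by rw [hi, hj])
    obtain hj | hj := h.eq_or_eq j hj _ hy.symm
    · right
      rw [h.injective hj, add_sub_cancel_right]
    · left
      rw [h.injective hj, sub_add_cancel]
  · exact h.eq_or_eq i hi y hy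

lemma degree_eq_two (h : IsRootedCycle G p d) (hn : 3 ≤ n) (hleaf : ∀ x, G.degree x ≠ 1)
    (i : ZMod n) : G.degree (p i) = 2 := by
  have : G.neighborFinset (p i) = {p (i + 1), p (i - 1)} := by
    ext y
    simp only [mem_neighborFinset, Finset.mem_insert, Finset.mem_singleton]
    refine ⟨h.eq_or_eq_of_forall_degree_ne_one hleaf, ?_⟩
    rintro (rfl | rfl)
    exacts [h.adj i, h.adj_sub_one i]
  rw [← card_neighborFinset_eq_degree, this,
    Finset.card_pair (h.injective.ne (ZMod.add_one_ne_sub_one hn i))]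

lemma mem_range_iff (h : IsRootedCycle G p d) (hn : 3 ≤ n) (hleaf : ∀ x, G.degree x ≠ 1) {x : V} :
    x ∈ Set.range p ↔ G.degree x ≠ 0 := by
  constructor
  · rintro ⟨i, rfl⟩
    simp [h.degree_eq_two hn hleaf i]
  · intro hx
    obtain ⟨y, hy⟩ := (G.degree_pos_iff_exists_adj x).mp (Nat.pos_of_ne_zero hx)
    exact h.mem_range_of_adj hleaf hy

end IsRootedCycle

end Unicyclic

section CycleWalk

lemma IsCycle.exists_zmod_parametrization {V : Type*} {G : SimpleGraph V} {v : V} {c : G.Walk v v}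
    (hc : c.IsCycle) : ∃ p : ZMod c.length → V, Function.Injective p ∧
      (∀ i, G.Adj (p i) (p (i + 1))) ∧ p 0 = v ∧ ∀ x, x ∈ Set.range p ↔ x ∈ c.support := by
  have h3 := hc.three_le_length
  have : NeZero c.length := ⟨by omega⟩
  have : Fact (1 < c.length) := ⟨by omega⟩
  refine ⟨fun i => c.getVert i.val, ?_, ?_, ?_, ?_⟩
  · intro i j hij
    have hi := ZMod.val_lt i
    have hj := ZMod.val_lt j
    exact ZMod.val_injective _ (hc.getVert_injOn' (by simp; omega) (by simp; omega) hij)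
  · intro i
    have hi := ZMod.val_lt i
    have hadj := c.adj_getVert_succ hi
    suffices h : c.getVert (i + 1).val = c.getVert (i.val + 1) by
      simpa only [h] using hadj
    rw [ZMod.val_add, ZMod.val_one]
    by_cases h : i.val + 1 < c.length
    · rw [Nat.mod_eq_of_lt h]
    · have h' : i.val + 1 = c.length := by omega
      rw [h', Nat.mod_self, c.getVert_zero, c.getVert_length]
  · simp
  · intro x
    rw [Walk.mem_support_iff_exists_getVert]
    constructor
    · rintro ⟨i, rfl⟩
      exact ⟨i.val, rfl, (ZMod.val_lt i).le⟩
    · rintro ⟨k, rfl, hk⟩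
      obtain hk | rfl := hk.lt_or_eq
      · exact ⟨k, by simp [ZMod.val_natCast, Nat.mod_eq_of_lt hk]⟩
      · exact ⟨0, by simp⟩

end CycleWalk

section Base

variable {V : Type*} [Fintype V] {G H : SimpleGraph V} {M : Matrix V V ℝ} {n : ℕ}
  {p : ZMod n → V} {d : V → ℕ}

lemma mulVec_eq_zero_of_degree_eq_zero
    (hd : RespectsLabels M (fun x => G.degree x) (fun x => H.degree x)) {u : V → ℝ}
    (hu : ∀ y, H.degree y = 0 → u y = 0) {x : V} (hx : G.degree x = 0) : (M *ᵥ u) x = 0 := by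
  refine Finset.sum_eq_zero fun y _ => ?_
  change M x y * u y = 0
  by_cases hxy : M x y = 0
  · rw [hxy, zero_mul]
  · rw [hu y ((hd x y hxy).symm.trans hx), mul_zero]

variable [DecidableEq V]

lemma lapMatrix_mul (hA : G.adjMatrix ℝ * M = M * H.adjMatrix ℝ)
    (hd : RespectsLabels M (fun x => G.degree x) (fun x => H.degree x)) :
    G.lapMatrix ℝ * M = M * H.lapMatrix ℝ := by
  have := diagonal_mul_eq_mul_diagonal_iff.mpr (hd.comp fun k => (k : ℝ))
  simp only [lapMatrix, SimpleGraph.degMatrix, Matrix.sub_mul, Matrix.mul_sub, hA]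
  congr 1

lemma mulVec_eq_of_adj (hA : G.adjMatrix ℝ * M = M * H.adjMatrix ℝ)
    (hd : RespectsLabels M (fun x => G.degree x) (fun x => H.degree x)) {u : V → ℝ}
    (hu : ∀ x y, H.Adj x y → u x = u y) {x y : V} (hxy : G.Adj x y) :
    (M *ᵥ u) x = (M *ᵥ u) y := by
  refine (lapMatrix_mulVec_eq_zero_iff_forall_adj G).mp ?_ x y hxy
  rw [Matrix.mulVec_mulVec, lapMatrix_mul hA hd, ← Matrix.mulVec_mulVec,
    (lapMatrix_mulVec_eq_zero_iff_forall_adj H).mpr hu, Matrix.mulVec_zero]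

namespace IsRootedCycle

lemma reachable_of_degree_ne_zero [NeZero n] (hp : IsRootedCycle G p d) (hn : 3 ≤ n)
    (hleaf : ∀ x, G.degree x ≠ 1) (hM : M.det ≠ 0)
    (hA : G.adjMatrix ℝ * M = M * H.adjMatrix ℝ)
    (hd : RespectsLabels M (fun x => G.degree x) (fun x => H.degree x)) {r y : V}
    (hr : H.degree r ≠ 0) (hy : H.degree y ≠ 0) : H.Reachable r y := by
  have hpos : ∀ {x z}, H.Adj x z → H.degree x ≠ 0 := fun hxz =>
    ((H.degree_pos_iff_exists_adj _).mpr ⟨_, hxz⟩).ne'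
  let u : V → ℝ := fun y => if H.Reachable r y then 1 else 0
  let w : V → ℝ := fun y => if H.degree y ≠ 0 then 1 else 0
  have hu : ∀ x y, H.Adj x y → u x = u y := fun x y hxy => by
    have : H.Reachable r x ↔ H.Reachable r y :=
      ⟨fun h => h.trans hxy.reachable, fun h => h.trans hxy.symm.reachable⟩
    simp only [u, this]
  have hw : ∀ x y, H.Adj x y → w x = w y := fun x y hxy => by
    simp [w, hpos hxy, hpos hxy.symm]
  have hu0 : ∀ y, H.degree y = 0 → u y = 0 := fun y hy => by
    refine if_neg fun hry => ?_
    obtain ⟨q⟩ := hry.symm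
    cases q with
    | nil => exact hr hy
    | cons hyz _ => exact hpos hyz hy
  have hw0 : ∀ y, H.degree y = 0 → w y = 0 := fun y hy => by simp [w, hy]
  have key : (M *ᵥ w) (p 0) • u - (M *ᵥ u) (p 0) • w = 0 := by
    refine eq_zero_of_mulVec_eq_zero hM (funext fun x => ?_)
    simp only [mulVec_sub, mulVec_smul, Pi.sub_apply, Pi.smul_apply, smul_eq_mul, Pi.zero_apply]
    by_cases hx : G.degree x = 0
    · simp [mulVec_eq_zero_of_degree_eq_zero hd hu0 hx, mulVec_eq_zero_of_degree_eq_zero hd hw0 hx]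
    · obtain ⟨i, rfl⟩ := (hp.mem_range_iff hn hleaf).mpr hx
      rw [ZMod.apply_eq_apply_zero (g := fun i => (M *ᵥ u) (p i))
          (fun i => (mulVec_eq_of_adj hA hd hu (hp.adj i)).symm) i,
        ZMod.apply_eq_apply_zero (g := fun i => (M *ᵥ w) (p i))
          (fun i => (mulVec_eq_of_adj hA hd hw (hp.adj i)).symm) i]
      ring
  have hur : u r = 1 := if_pos (Reachable.refl r)
  have hwr : w r = 1 := if_pos hr
  have hwy : w y = 1 := if_pos hy
  have h1 := congrFun key r
  have h2 := congrFun key y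
  simp only [Pi.sub_apply, Pi.smul_apply, smul_eq_mul, Pi.zero_apply, hur, hwr, hwy] at h1 h2
  have hne : (M *ᵥ u) (p 0) ≠ 0 := by
    intro h0
    have hMu : M *ᵥ u = 0 := by
      funext x
      by_cases hx : G.degree x = 0
      · exact mulVec_eq_zero_of_degree_eq_zero hd hu0 hx
      · obtain ⟨i, rfl⟩ := (hp.mem_range_iff hn hleaf).mpr hx
        rw [ZMod.apply_eq_apply_zero (g := fun i => (M *ᵥ u) (p i))
          (fun i => (mulVec_eq_of_adj hA hd hu (hp.adj i)).symm) i, h0]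
        rfl
    simp [eq_zero_of_mulVec_eq_zero hM hMu] at hur
  by_contra hcon
  have huy : u y = 0 := if_neg hcon
  rw [huy] at h2
  apply hne
  linarith

lemma exists_iso_of_forall_degree_ne_one [NeZero n] (hp : IsRootedCycle G p d) (hn : 3 ≤ n)
    (hleaf : ∀ x, G.degree x ≠ 1) (hM : M.det ≠ 0)
    (hA : G.adjMatrix ℝ * M = M * H.adjMatrix ℝ)
    (hd : RespectsLabels M (fun x => G.degree x) (fun x => H.degree x)) {α : Type*} {f h : V → α}
    (hf : RespectsLabels M f h) {t : α} (ht : ∀ i, i ≠ 0 → f (p i) = t) :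
    ∃ φ : G ≃g H, ∀ x, h (φ x) = f x := by
  obtain ⟨σ, hσ⟩ := exists_perm_apply_ne_zero hM
  have hσd : ∀ y, G.degree (σ y) = H.degree y := fun y => hd _ _ (hσ y)
  have hσf : ∀ y, f (σ y) = h y := fun y => hf _ _ (hσ y)
  have hrange : ∀ y, σ y ∈ Set.range p ↔ H.degree y ≠ 0 := fun y => by
    rw [hp.mem_range_iff hn hleaf, hσd]
  have hH2 : ∀ y, H.degree y ≠ 0 → H.degree y = 2 := fun y hy => by
    obtain ⟨i, hi⟩ := (hrange y).mpr hy
    rw [← hσd, ← hi, hp.degree_eq_two hn hleaf]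
  have hcycles : H.IsCycles := by
    intro v hv
    obtain ⟨w, hw⟩ := hv
    rw [Set.ncard_eq_toFinset_card', ← neighborFinset_def, card_neighborFinset_eq_degree]
    exact hH2 v ((H.degree_pos_iff_exists_adj v).mpr ⟨w, hw⟩).ne'
  have hr : H.degree (σ.symm (p 0)) ≠ 0 := by
    rw [← hrange]
    simp
  obtain ⟨w, hw⟩ := (H.degree_pos_iff_exists_adj _).mp (Nat.pos_of_ne_zero hr)
  obtain ⟨c, hc, hcs⟩ := hcycles.exists_cycle_toSubgraph_verts_eq_connectedComponentSupp
    (c := H.connectedComponentMk (σ.symm (p 0))) rfl ⟨w, hw⟩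
  obtain ⟨p', hinj, hadj, hp0, hrange'⟩ := IsCycle.exists_zmod_parametrization hc
  have hsupp : ∀ y, y ∈ Set.range p' ↔ H.degree y ≠ 0 := fun y => by
    rw [hrange', ← Walk.mem_verts_toSubgraph, hcs, ConnectedComponent.mem_supp_iff,
      ConnectedComponent.eq]
    constructor
    · rintro ⟨q⟩
      cases q with
      | nil => exact hr
      | cons hyz _ => exact ((H.degree_pos_iff_exists_adj _).mpr ⟨_, hyz⟩).ne'
    · intro hy
      exact hp.reachable_of_degree_ne_zero hn hleaf hM hA hd hy hr
  have hmem : ∀ y, σ y ∈ Set.range p ↔ y ∈ Set.range p' := fun y => by rw [hrange, hsupp]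
  have hlen : c.length = n := by
    refine (Nat.card_zmod _).symm.trans (Eq.trans ?_ (Nat.card_zmod n))
    exact Nat.card_congr ((Equiv.ofInjective p' hinj).trans
      ((σ.subtypeEquiv fun y => (hmem y).symm).trans (Equiv.ofInjective p hp.injective).symm))
  generalize c.length = m at *
  subst hlen
  let ψ : Equiv.Perm V := Equiv.subtypeCongr (p := (· ∈ Set.range p)) (q := (· ∈ Set.range p'))
    ((Equiv.ofInjective p hp.injective).symm.trans (Equiv.ofInjective p' hinj))
    (σ.symm.subtypeEquiv fun x => by rw [← hmem, σ.apply_symm_apply])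
  have hψ1 : ∀ i, ψ (p i) = p' i := fun i => by
    simp only [ψ, Equiv.subtypeCongr, Equiv.trans_apply]
    rw [Equiv.sumCompl_symm_apply_of_pos (p := (· ∈ Set.range p)) ⟨i, rfl⟩]
    simp [Equiv.ofInjective_symm_apply]
  have hψ2 : ∀ x, x ∉ Set.range p → ψ x = σ.symm x := fun x hx => by
    simp only [ψ, Equiv.subtypeCongr, Equiv.trans_apply]
    rw [Equiv.sumCompl_symm_apply_of_neg (p := (· ∈ Set.range p)) hx]
    rfl
  have hhom : ∀ x y, G.Adj x y → H.Adj (ψ x) (ψ y) := by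
    intro x y hxy
    obtain ⟨i, rfl⟩ := hp.mem_range_of_adj hleaf hxy
    obtain rfl | rfl := hp.eq_or_eq_of_forall_degree_ne_one hleaf hxy
    · rw [hψ1, hψ1]
      exact hadj i
    · rw [hψ1, hψ1]
      simpa using (hadj (i - 1)).symm
  refine ⟨⟨ψ, adj_iff_of_perm_hom ψ hhom (card_edgeFinset_eq_of_degree_perm σ hσd)⟩, fun x => ?_⟩
  change h (ψ x) = f x
  by_cases hx : x ∈ Set.range p
  · obtain ⟨i, rfl⟩ := hx
    rw [hψ1]
    by_cases hi : i = 0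
    · rw [hi, hp0, ← hσf, σ.apply_symm_apply]
    · obtain ⟨j, hj⟩ := (hmem (p' i)).mpr ⟨i, rfl⟩
      have hj0 : j ≠ 0 := by
        rintro rfl
        rw [← σ.symm_apply_eq, ← hp0] at hj
        exact hi (hinj hj).symm
      rw [ht i hi, ← hσf, ← hj, ht j hj0]
  · rw [hψ2 x hx, ← hσf, σ.apply_symm_apply]

end IsRootedCycle

end Base

section Induction

variable {V : Type*} [Fintype V] {n : ℕ} {p : ZMod n → V} {d : V → ℕ}

lemma card_edgeFinset_prune_lt {G : SimpleGraph V} {x : V} (hx : G.degree x = 1) :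
    (prune G).edgeFinset.card < G.edgeFinset.card := by
  refine Finset.card_lt_card (edgeFinset_ssubset_edgeFinset.mpr (lt_of_le_of_ne
    (fun a b hab => hab.1) fun heq => ?_))
  have h0 := degree_prune_of_eq_one hx
  rw [heq, hx] at h0
  exact one_ne_zero h0

variable [DecidableEq V] {M : Matrix V V ℝ}

/-- A graph whose only cycle has a single branching vertex is determined by any invertible matrix
intertwining adjacency and degrees; the isomorphism moreover preserves every labelling that the
matrix respects, provided that it is constant on the nonbranching cycle vertices. -/
theorem IsRootedCycle.exists_iso [NeZero n] (hn : 3 ≤ n) (hM : M.det ≠ 0) {G H : SimpleGraph V}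
    (hp : IsRootedCycle G p d) (hA : G.adjMatrix ℝ * M = M * H.adjMatrix ℝ)
    (hd : RespectsLabels M (fun x => G.degree x) (fun x => H.degree x)) {α : Type*} {f h : V → α}
    (hf : RespectsLabels M f h) {t : α} (ht : ∀ i, i ≠ 0 → f (p i) = t) :
    ∃ φ : G ≃g H, ∀ x, h (φ x) = f x := by
  induction hk : G.edgeFinset.card using Nat.strong_induction_on generalizing G H α t with
  | _ k ih =>
  by_cases hleaf : ∃ x, G.degree x = 1
  · obtain ⟨x, hx⟩ := hleaf
    have hcount : RespectsLabels M (fun x a => leafCount G (fun y => f y = a) x)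
        (fun x a => leafCount H (fun y => h y = a) x) := fun x y hxy =>
      funext fun a => RespectsLabels.leafCount hA hd (hf.comp (· = a)) x y hxy
    obtain ⟨φ, hφ⟩ := ih _ (hk ▸ card_edgeFinset_prune_lt hx) (hp.prune hn)
      (adjMatrix_prune_mul hA hd) (RespectsLabels.degree_prune hA hd)
      (hf.prodMk ((hd.comp (· = 1)).prodMk hcount)) (t := (t, False, fun _ => 0))
      (fun i hi => by simp [ht i hi, hp.degree_ne_one hn i, hp.leafCount_eq_zero hn hi]) rfl
    simp only [Prod.mk.injEq, eq_iff_iff] at hφ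
    obtain ⟨σ, hσ⟩ := exists_perm_apply_ne_zero hM
    exact exists_iso_of_iso_prune (card_edgeFinset_eq_of_degree_perm σ fun y => hd _ _ (hσ y))
      (fun x y hx hxy => hp.degree_ne_one_of_adj_leaf hn hx hxy) φ (fun x => (hφ x).1)
      (fun x => (hφ x).2.1) (fun x a => congrFun (hφ x).2.2 a)
  · exact hp.exists_iso_of_forall_degree_ne_one hn (not_exists.mp hleaf) hM hA hd hf ht

end Induction

section RootedTree

lemma exists_adj_dist_lt {V : Type*} {T : SimpleGraph V} (hT : T.Connected) {r x : V} (hx : x ≠ r) :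
    ∃ y, T.Adj x y ∧ T.dist r y < T.dist r x := by
  obtain ⟨P, hP⟩ := hT.exists_walk_length_eq_dist x r
  cases P with
  | nil => exact absurd rfl hx
  | @cons _ y _ hxy P =>
    refine ⟨y, hxy, ?_⟩
    rw [T.dist_comm (u := r) (v := x), ← hP, Walk.length_cons, T.dist_comm (u := r) (v := y)]
    exact Nat.lt_succ_of_le (dist_le P)

lemma eq_of_adj_of_dist_le {V : Type*} {T : SimpleGraph V} (hT : T.IsTree) {r x y z : V}
    (hy : T.Adj x y) (hz : T.Adj x z) (hdy : T.dist r y ≤ T.dist r x)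
    (hdz : T.dist r z ≤ T.dist r x) : y = z := by
  obtain ⟨P, hP, hlen⟩ := hT.connected.exists_path_of_dist r x
  have key : ∀ w, T.Adj x w → T.dist r w ≤ T.dist r x → w = P.penultimate := by
    intro w hw hdw
    have hmem : w ∈ P.support := by
      by_contra hcon
      obtain ⟨Q, hQ, hQlen⟩ := hT.connected.exists_path_of_dist r w
      have := (hT.isAcyclic.subsingleton_path r w).elim ⟨Q, hQ⟩
        ⟨P.concat hw, hP.concat hcon hw⟩
      have h2 : Q = P.concat hw := congrArg Subtype.val this
      rw [h2, Walk.length_concat] at hQlen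
      omega
    exact hT.isAcyclic.eq_penultimate_of_adj_end hP hw hmem
  rw [key y hy hdy, key z hz hdz]

end RootedTree

lemma Unicyclic.exists_isRootedCycle {V : Type*} [Fintype V] [DecidableEq V] {U : SimpleGraph V}
    (hU : Unicyclic U) {r : V} {c : U.Walk r r} (hc : c.IsCycle)
    (hdeg : ∀ v ∈ c.support, v ≠ r → U.degree v = 2) :
    ∃ (p : ZMod c.length → V) (d : V → ℕ), IsRootedCycle U p d := by
  obtain ⟨hconn, hcard⟩ := hU
  obtain ⟨p, hinj, hadj, hp0, hrange⟩ := IsCycle.exists_zmod_parametrization hc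
  have hmem : s(r, c.snd) ∈ c.edges := c.mk_start_snd_mem_edges hc.not_nil
  have hT : (U.deleteEdges {s(r, c.snd)}).IsTree := by
    refine isTree_iff_connected_and_card.mpr ⟨hconn.connected_delete_edge_of_not_isBridge
      fun hb => hb.notMem_edges_of_isCycle hc hmem, ?_⟩
    rw [edgeSet_deleteEdges, Nat.card_coe_set_eq,
      Set.ncard_sdiff_singleton_add_one (c.edges_subset_edgeSet hmem), Nat.card_eq_fintype_card,
      ← hcard, ← coe_edgeFinset, Set.ncard_coe_finset]
  have hTadj : ∀ {x y}, x ∉ Set.range p →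
      (U.Adj x y ↔ (U.deleteEdges {s(r, c.snd)}).Adj x y) := by
    intro x y hx
    rw [deleteEdges_adj, Set.mem_singleton_iff, iff_self_and]
    intro _ heq
    rw [hrange] at hx
    rcases Sym2.eq_iff.mp heq with ⟨rfl, -⟩ | ⟨rfl, -⟩
    · exact hx c.start_mem_support
    · exact hx (c.getVert_mem_support 1)
  refine ⟨p, (U.deleteEdges {s(r, c.snd)}).dist r, hinj, hadj, ?_, ?_, ?_, ?_⟩
  · intro i hi y hy
    have hadj' : U.Adj (p i) (p (i - 1)) := by simpa using (hadj (i - 1)).symm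
    have h2 : (U.neighborFinset (p i)).card = 2 := by
      rw [card_neighborFinset_eq_degree]
      exact hdeg _ ((hrange _).mp ⟨i, rfl⟩) (hp0 ▸ hinj.ne hi)
    have hsub : {p (i + 1), p (i - 1)} ⊆ U.neighborFinset (p i) := by
      simp [Finset.insert_subset_iff, hadj i, hadj']
    have heq := Finset.eq_of_subset_of_card_le hsub (by
      rw [h2, Finset.card_pair (hinj.ne (ZMod.add_one_ne_sub_one hc.three_le_length i))])
    simpa [← heq] using (U.mem_neighborFinset (p i) y).mpr hy
  · rw [hp0, dist_self]
  · intro x hx _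
    obtain ⟨y, hy, hlt⟩ := exists_adj_dist_lt hT.connected (r := r) (x := x) (by
      rintro rfl
      exact hx ⟨0, hp0⟩)
    exact ⟨y, (hTadj hx).mpr hy, hlt⟩
  · intro x hx y z hy hz
    exact eq_of_adj_of_dist_le hT ((hTadj hx).mp hy) ((hTadj hx).mp hz)

end DegreeSimilarity

/-- Let `U` be unicyclic with (unique) cycle `c` through a vertex `r` such that every
vertex of the cycle other than `r` has degree `2` in `U`, `deg_U r ≥ 5`, and every
vertex off the cycle has degree different from `2` and strictly less than
`deg_U r - 2`.  (Equivalently, `U = C_g(r) ⊙ T(v)` where the tree `T` has no vertex of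
degree `2` and `v` is its unique vertex of maximum degree.)  Then `U` is degree-similar
determined. -/
theorem stmt12 {V : Type*} [Fintype V] [DecidableEq V]
    (U : SimpleGraph V) (hU : Unicyclic U)
    (r : V) (c : U.Walk r r) (hc : c.IsCycle)
    (hcyc2 : ∀ v ∈ c.support, v ≠ r → U.degree v = 2)
    (hr : 5 ≤ U.degree r)
    (hoff : ∀ v : V, v ∉ c.support → U.degree v ≠ 2 ∧ U.degree v < U.degree r - 2) :
    ∀ G : SimpleGraph V, DegreeSimilar U G → Nonempty (U ≃g G) := by
  intro G hG
  obtain ⟨M, hM, hA, hD⟩ := hG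
  have conj : ∀ {A B : Matrix V V ℝ}, M⁻¹ * A * M = B → A * M = M * B := by
    rintro A _ rfl
    rw [Matrix.mul_assoc, Matrix.mul_nonsing_inv_cancel_left M _ hM]
  have hd : RespectsLabels M (fun x => U.degree x) (fun x => G.degree x) := fun x y hxy =>
    Nat.cast_injective (diagonal_mul_eq_mul_diagonal_iff.mp (conj hD) x y hxy)
  obtain ⟨p, d, hp⟩ := hU.exists_isRootedCycle hc hcyc2
  have h3 := hc.three_le_length
  have : NeZero c.length := ⟨by omega⟩
  obtain ⟨φ, -⟩ := hp.exists_iso h3 hM.ne_zero (conj hA) hd (f := fun _ => ()) (h := fun _ => ())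
    (fun _ _ _ => rfl) (fun _ _ => rfl)
  exact ⟨φ⟩
end

section
/- If U₁ and U₂ are degree-similar unicyclic graphs on a common finite vertex set, then U₁ and U₂ have the same girth. -/
open scoped Classical

section NonBacktracking

open Finset SimpleGraph

lemma sum_adjMatrix_left {V : Type*} [Fintype V] (G : SimpleGraph V) (x : V) :
    ∑ w, G.adjMatrix ℝ w x = G.degree x := by
  simp [adjMatrix_apply, G.adj_comm _ x, ← card_neighborFinset_eq_degree,
    neighborFinset_eq_filter]

variable {V : Type*} [Fintype V] [DecidableEq V]

/-- The number of non-backtracking walks of length `k + 1` in `G` from `x` to `u` whose first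
step goes from `x` to `w`. -/
noncomputable def nonBacktrackingCount (G : SimpleGraph V) : ℕ → V → V → V → ℝ
  | 0, x, w, u => if G.Adj x w ∧ w = u then 1 else 0
  | k + 1, x, w, u =>
    if G.Adj x w then ∑ y, if y = x then 0 else nonBacktrackingCount G k w y u else 0

/-- The matrix counting the non-backtracking walks of length `k + 1` in `G`. -/
noncomputable def nonBacktrackingMatrix (G : SimpleGraph V) (k : ℕ) : Matrix V V ℝ :=
  Matrix.of fun x u => ∑ w, nonBacktrackingCount G k x w u

/-- The recursion satisfied by the matrices counting non-backtracking walks, as a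
noncommutative polynomial in the adjacency matrix `A` and the degree matrix `D`. -/
noncomputable def nonBacktrackingPoly (A D : Matrix V V ℝ) : ℕ → Matrix V V ℝ
  | 0 => A
  | 1 => A * A - D
  | k + 2 => A * nonBacktrackingPoly A D (k + 1) - (D - 1) * nonBacktrackingPoly A D k

lemma nonBacktrackingPoly_conj {M : Matrix V V ℝ} (hM : IsUnit M.det) (A D : Matrix V V ℝ)
    (k : ℕ) : nonBacktrackingPoly (M⁻¹ * A * M) (M⁻¹ * D * M) k =
      M⁻¹ * nonBacktrackingPoly A D k * M := by
  have hmul (X Y : Matrix V V ℝ) : M⁻¹ * X * M * (M⁻¹ * Y * M) = M⁻¹ * (X * Y) * M := by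
    calc M⁻¹ * X * M * (M⁻¹ * Y * M) = M⁻¹ * X * (M * M⁻¹) * Y * M := by
          simp only [Matrix.mul_assoc]
      _ = M⁻¹ * (X * Y) * M := by
          rw [Matrix.mul_nonsing_inv _ hM]; simp only [Matrix.mul_assoc, Matrix.mul_one]
  have hone : M⁻¹ * D * M - 1 = M⁻¹ * (D - 1) * M := by
    rw [Matrix.mul_sub, Matrix.sub_mul, Matrix.mul_one, Matrix.nonsing_inv_mul _ hM]
  induction k using Nat.twoStepInduction with
  | zero => rfl
  | one => simp only [nonBacktrackingPoly, hmul, Matrix.mul_sub, Matrix.sub_mul]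
  | more k ih₁ ih₂ =>
    simp only [nonBacktrackingPoly]
    rw [ih₁, ih₂, hone, hmul, hmul, ← Matrix.sub_mul, ← Matrix.mul_sub]

lemma nonBacktrackingCount_nonneg (G : SimpleGraph V) (k : ℕ) (x w u : V) :
    0 ≤ nonBacktrackingCount G k x w u := by
  induction k generalizing x w with
  | zero => simp only [nonBacktrackingCount]; split_ifs <;> norm_num
  | succ k ih =>
    simp only [nonBacktrackingCount]
    split_ifs
    · exact sum_nonneg fun y _ => by split_ifs; exacts [le_rfl, ih w y]
    · exact le_rfl

lemma nonBacktrackingCount_of_not_adj {G : SimpleGraph V} {x w : V} (h : ¬ G.Adj x w) (k : ℕ)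
    (u : V) : nonBacktrackingCount G k x w u = 0 := by
  cases k <;> simp [nonBacktrackingCount, h]

lemma nonBacktrackingCount_succ (G : SimpleGraph V) (k : ℕ) (x w u : V) :
    nonBacktrackingCount G (k + 1) x w u = G.adjMatrix ℝ x w *
      (nonBacktrackingMatrix G k w u - nonBacktrackingCount G k w x u) := by
  have h : (∑ y, if y = x then 0 else nonBacktrackingCount G k w y u) =
      nonBacktrackingMatrix G k w u - nonBacktrackingCount G k w x u := by
    rw [eq_sub_iff_add_eq, nonBacktrackingMatrix, Matrix.of_apply,
      ← sum_erase_add univ _ (mem_univ x), ← sum_erase_add univ _ (mem_univ x), if_pos rfl,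
      add_zero]
    congr 1
    exact sum_congr rfl fun y hy => if_neg (ne_of_mem_erase hy)
  rw [nonBacktrackingCount, h, adjMatrix_apply]
  split_ifs <;> simp

lemma adjMatrix_mul_nonBacktrackingCount (G : SimpleGraph V) (k : ℕ) (x w u : V) :
    G.adjMatrix ℝ x w * nonBacktrackingCount G k w x u = nonBacktrackingCount G k w x u := by
  rw [adjMatrix_apply]
  split_ifs with h
  · exact one_mul _
  · rw [nonBacktrackingCount_of_not_adj (fun h' => h h'.symm), mul_zero]

lemma nonBacktrackingMatrix_succ_apply (G : SimpleGraph V) (k : ℕ) (x u : V) :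
    nonBacktrackingMatrix G (k + 1) x u =
      (G.adjMatrix ℝ * nonBacktrackingMatrix G k) x u -
        ∑ w, nonBacktrackingCount G k w x u := by
  rw [Matrix.mul_apply, ← sum_sub_distrib]
  refine sum_congr rfl fun w _ => ?_
  rw [nonBacktrackingCount_succ, mul_sub, adjMatrix_mul_nonBacktrackingCount]

lemma nonBacktrackingMatrix_eq_poly (G : SimpleGraph V) (k : ℕ) :
    nonBacktrackingMatrix G k = nonBacktrackingPoly (G.adjMatrix ℝ) (degMatrix G) k := by
  have h₀ : nonBacktrackingMatrix G 0 = G.adjMatrix ℝ := by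
    ext x u
    simp [nonBacktrackingMatrix, nonBacktrackingCount, and_comm, ite_and, adjMatrix_apply]
  induction k using Nat.twoStepInduction with
  | zero => exact h₀
  | one =>
    ext x u
    rw [nonBacktrackingMatrix_succ_apply, h₀, nonBacktrackingPoly, Matrix.sub_apply,
      _root_.degMatrix, Matrix.diagonal_apply, ← sum_adjMatrix_left]
    congr 1
    by_cases h : x = u <;> simp [nonBacktrackingCount, h, adjMatrix_apply]
  | more k ih₁ ih₂ =>
    ext x u
    rw [nonBacktrackingMatrix_succ_apply, nonBacktrackingPoly, ← ih₁, ← ih₂, Matrix.sub_apply,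
      Matrix.sub_mul, Matrix.sub_apply, Matrix.one_mul, _root_.degMatrix, Matrix.diagonal_mul,
      ← sum_adjMatrix_left, sum_mul]
    congr 1
    conv_rhs => rw [nonBacktrackingMatrix, Matrix.of_apply]
    rw [← sum_sub_distrib]
    refine sum_congr rfl fun w _ => ?_
    rw [nonBacktrackingCount_succ, mul_sub, adjMatrix_mul_nonBacktrackingCount]
    rfl

/-- A non-backtracking walk shorter than the girth is a path. -/
lemma exists_isPath_of_nonBacktrackingCount_ne_zero {G : SimpleGraph V} {k : ℕ} {x w u : V}
    (hk : ((k + 1 : ℕ) : ℕ∞) < G.egirth) (h : nonBacktrackingCount G k x w u ≠ 0) :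
    ∃ (hxw : G.Adj x w) (p : G.Walk w u), p.length = k ∧ (Walk.cons hxw p).IsPath := by
  induction k generalizing x w with
  | zero =>
    simp only [nonBacktrackingCount, ne_eq, ite_eq_right_iff, one_ne_zero, imp_false,
      not_not] at h
    obtain ⟨hxw, rfl⟩ := h
    exact ⟨hxw, Walk.nil, rfl, by simpa using hxw.ne⟩
  | succ k ih =>
    have hxw : G.Adj x w := by
      by_contra hn
      exact h (nonBacktrackingCount_of_not_adj hn _ _)
    rw [nonBacktrackingCount, if_pos hxw] at h
    obtain ⟨y, -, hy⟩ := exists_ne_zero_of_sum_ne_zero h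
    rw [ne_eq, ite_eq_left_iff, Classical.not_imp] at hy
    obtain ⟨hyx, hy⟩ := hy
    obtain ⟨hwy, p, hp, hpath⟩ :=
      ih (lt_of_le_of_lt (by exact_mod_cast Nat.le_succ (k + 1)) hk) hy
    refine ⟨hxw, Walk.cons hwy p, by simp [hp], ?_⟩
    rw [Walk.cons_isPath_iff]
    refine ⟨hpath, fun hx => ?_⟩
    set q := (Walk.cons hwy p).takeUntil x hx with hq
    have hqp : q.IsPath := hpath.takeUntil hx
    have hlen : q.length ≤ k + 1 := by
      simpa [hp] using (Walk.cons hwy p).length_takeUntil_le_length hx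
    by_cases he : s(x, w) ∈ q.edges
    · have h1 : q.length = 1 := hqp.length_eq_one_of_mem_edges (Sym2.eq_swap ▸ he)
      have h2 : q.getVert 1 = x := h1 ▸ q.getVert_length
      rw [hq, Walk.getVert_takeUntil hx h1.ge] at h2
      exact hyx (by simpa using h2)
    · have hc : (Walk.cons hxw q).IsCycle := (Walk.cons_isCycle_iff q hxw).2 ⟨hqp, he⟩
      refine absurd (hk.trans_le (egirth_le_length hc)) (not_lt.2 ?_)
      rw [Walk.length_cons]
      exact_mod_cast Nat.succ_le_succ hlen

lemma nonBacktrackingCount_pos_of_isPath {G : SimpleGraph V} {x w u : V} (hxw : G.Adj x w)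
    {p : G.Walk w u} (hp : p.IsPath) (he : s(x, w) ∉ p.edges) :
    0 < nonBacktrackingCount G p.length x w u := by
  induction p generalizing x with
  | nil => simp [nonBacktrackingCount, hxw]
  | @cons w y u hwy p ih =>
    rw [Walk.cons_isPath_iff] at hp
    rw [Walk.length_cons, nonBacktrackingCount, if_pos hxw]
    have hyx : y ≠ x := by
      rintro rfl
      exact he (by simp [Sym2.eq_swap])
    refine sum_pos' (fun z _ => ?_) ⟨y, mem_univ y, ?_⟩
    · split_ifs
      exacts [le_rfl, nonBacktrackingCount_nonneg _ _ _ _ _]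
    · rw [if_neg hyx]
      exact ih hwy hp.1 fun h => hp.2 (p.fst_mem_support_of_mem_edges h)

lemma trace_nonBacktrackingMatrix_eq_zero {G : SimpleGraph V} {k : ℕ}
    (hk : ((k + 1 : ℕ) : ℕ∞) < G.egirth) : (nonBacktrackingMatrix G k).trace = 0 := by
  refine sum_eq_zero fun x _ => sum_eq_zero fun w _ => ?_
  by_contra h
  obtain ⟨hxw, p, -, hpath⟩ := exists_isPath_of_nonBacktrackingCount_ne_zero hk h
  exact ((Walk.cons_isPath_iff _ _).1 hpath).2 p.end_mem_support

lemma trace_nonBacktrackingMatrix_pos {G : SimpleGraph V} {v : V} {c : G.Walk v v}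
    (hc : c.IsCycle) : 0 < (nonBacktrackingMatrix G (c.length - 1)).trace := by
  cases c with
  | nil => exact absurd hc Walk.not_isCycle_nil
  | @cons _ w _ h p =>
    rw [Walk.cons_isCycle_iff] at hc
    have hnonneg (x w u : V) := nonBacktrackingCount_nonneg G p.length x w u
    rw [Walk.length_cons, Nat.add_sub_cancel]
    exact sum_pos' (fun x _ => sum_nonneg fun w _ => hnonneg x w x)
      ⟨v, mem_univ v, sum_pos' (fun w _ => hnonneg v w v)
        ⟨w, mem_univ w, nonBacktrackingCount_pos_of_isPath h hc.1 hc.2⟩⟩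

lemma DegreeSimilar.trace_nonBacktrackingMatrix_eq {G₁ G₂ : SimpleGraph V}
    (h : DegreeSimilar G₁ G₂) (k : ℕ) :
    (nonBacktrackingMatrix G₁ k).trace = (nonBacktrackingMatrix G₂ k).trace := by
  obtain ⟨M, hM, hA, hD⟩ := h
  rw [nonBacktrackingMatrix_eq_poly G₂, ← hA, ← hD, nonBacktrackingPoly_conj hM,
    Matrix.trace_mul_comm, ← Matrix.mul_assoc, Matrix.mul_nonsing_inv _ hM, Matrix.one_mul,
    nonBacktrackingMatrix_eq_poly]

lemma egirth_le_of_trace_nonBacktrackingMatrix_eq {G₁ G₂ : SimpleGraph V}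
    (h : ∀ k, (nonBacktrackingMatrix G₁ k).trace = (nonBacktrackingMatrix G₂ k).trace) :
    G₁.egirth ≤ G₂.egirth := by
  refine le_egirth.2 fun v c hc => ?_
  by_contra! hlt
  have hlen : c.length - 1 + 1 = c.length := by have := hc.three_le_length; omega
  exact (trace_nonBacktrackingMatrix_pos hc).ne'
    ((h _).symm.trans (trace_nonBacktrackingMatrix_eq_zero (hlen.symm ▸ hlt)))

/-- Degree-similar graphs have the same extended girth. -/
theorem DegreeSimilar.egirth_eq {G₁ G₂ : SimpleGraph V} (h : DegreeSimilar G₁ G₂) :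
    G₁.egirth = G₂.egirth :=
  le_antisymm
    (egirth_le_of_trace_nonBacktrackingMatrix_eq h.trace_nonBacktrackingMatrix_eq)
    (egirth_le_of_trace_nonBacktrackingMatrix_eq
      fun k => (h.trace_nonBacktrackingMatrix_eq k).symm)

end NonBacktracking

/-- Degree-similar unicyclic graphs have the same girth. -/
theorem stmt13 {V : Type*} [Fintype V] [DecidableEq V]
    (U₁ U₂ : SimpleGraph V) (h₁ : Unicyclic U₁) (h₂ : Unicyclic U₂)
    (hds : DegreeSimilar U₁ U₂) :
    U₁.girth = U₂.girth := by
  rw [SimpleGraph.girth, SimpleGraph.girth, hds.egirth_eq]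
end

section
/- If G₁ and G₂ are degree-similar graphs on a common finite vertex set V, then the number of connected components of G₁ equals the number of connected components of G₂. -/
open scoped Classical

theorem lapMatrix_eq_degMatrix_sub_adjMatrix {V : Type*} [Fintype V] [DecidableEq V]
    (G : SimpleGraph V) : G.lapMatrix ℝ = degMatrix G - G.adjMatrix ℝ := by
  simp only [SimpleGraph.lapMatrix, SimpleGraph.degMatrix, degMatrix]

theorem card_connectedComponent_add_rank_lapMatrix {V : Type*} [Fintype V] [DecidableEq V]
    (G : SimpleGraph V) :
    Nat.card G.ConnectedComponent + (G.lapMatrix ℝ).rank = Fintype.card V := by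
  rw [Nat.card_eq_fintype_card,
    SimpleGraph.card_connectedComponent_eq_finrank_ker_toLin'_lapMatrix, Matrix.rank,
    ← Matrix.toLin'_apply', add_comm, LinearMap.finrank_range_add_finrank_ker,
    Module.finrank_fintype_fun_eq_card]

/-- Degree-similar graphs have the same number of connected components. -/
theorem stmt15 {V : Type*} [Fintype V] [DecidableEq V]
    (G₁ G₂ : SimpleGraph V) (hds : DegreeSimilar G₁ G₂) :
    Nat.card G₁.ConnectedComponent = Nat.card G₂.ConnectedComponent := by
  obtain ⟨M, hM, hA, hD⟩ := hds
  have hL : M⁻¹ * G₁.lapMatrix ℝ * M = G₂.lapMatrix ℝ := by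
    simp only [lapMatrix_eq_degMatrix_sub_adjMatrix, mul_sub, sub_mul, hA, hD]
  have hrank : (G₂.lapMatrix ℝ).rank = (G₁.lapMatrix ℝ).rank := by
    rw [← hL, Matrix.rank_mul_eq_left_of_isUnit_det _ _ hM,
      Matrix.rank_mul_eq_right_of_isUnit_det _ _ (M.isUnit_nonsing_inv_det hM)]
  have h₁ := card_connectedComponent_add_rank_lapMatrix G₁
  have h₂ := card_connectedComponent_add_rank_lapMatrix G₂
  lia
end

section
/- If G₁ and G₂ are degree-similar graphs on a common finite vertex set V, then the number of connected components of G₁ whose induced subgraph is bipartite (2-colorable) equals the number of connected components of G₂ whose induced subgraph is bipartite. -/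
open scoped Classical

/-- The signless Laplacian `D + A` of a graph, over `ℝ`. -/
noncomputable def signlessLap {V : Type*} [Fintype V] [DecidableEq V] (G : SimpleGraph V) :
    Matrix V V ℝ :=
  degMatrix G + G.adjMatrix ℝ

lemma signlessLap_mulVec_apply {V : Type*} [Fintype V] [DecidableEq V]
    (G : SimpleGraph V) (x : V → ℝ) (i : V) :
    (signlessLap G).mulVec x i = ∑ j, if G.Adj i j then x i + x j else 0 := by
  rw [signlessLap, degMatrix, Matrix.add_mulVec, Pi.add_apply, Matrix.mulVec_diagonal,
    SimpleGraph.adjMatrix_mulVec_apply, SimpleGraph.neighborFinset_eq_filter,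
    Finset.sum_filter, SimpleGraph.degree_eq_sum_if_adj, Finset.sum_mul,
    ← Finset.sum_add_distrib]
  refine Finset.sum_congr rfl fun j _ => ?_
  split_ifs <;> ring

/-- Twice the quadratic form of the signless Laplacian is the sum of `(x i + x j) ^ 2` over
ordered adjacent pairs. -/
lemma two_mul_dotProduct_signlessLap_mulVec {V : Type*} [Fintype V] [DecidableEq V]
    (G : SimpleGraph V) (x : V → ℝ) :
    2 * (x ⬝ᵥ (signlessLap G).mulVec x) =
      ∑ i, ∑ j, if G.Adj i j then (x i + x j) ^ 2 else 0 := by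
  have hq : x ⬝ᵥ (signlessLap G).mulVec x =
      ∑ i, ∑ j, if G.Adj i j then x i ^ 2 + x i * x j else 0 := by
    simp only [dotProduct, signlessLap_mulVec_apply, Finset.mul_sum]
    refine Finset.sum_congr rfl fun i _ => Finset.sum_congr rfl fun j _ => ?_
    split_ifs <;> ring
  have hswap : x ⬝ᵥ (signlessLap G).mulVec x =
      ∑ i, ∑ j, if G.Adj i j then x j ^ 2 + x j * x i else 0 := by
    rw [hq, Finset.sum_comm]
    simp only [G.adj_comm]
  rw [two_mul]
  nth_rewrite 1 [hq]
  rw [hswap, ← Finset.sum_add_distrib]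
  refine Finset.sum_congr rfl fun i _ => ?_
  rw [← Finset.sum_add_distrib]
  refine Finset.sum_congr rfl fun j _ => ?_
  split_ifs <;> ring

/-- The kernel of the signless Laplacian consists of the vectors that change sign along
every edge. -/
lemma signlessLap_mulVec_eq_zero_iff {V : Type*} [Fintype V] [DecidableEq V]
    (G : SimpleGraph V) (x : V → ℝ) :
    (signlessLap G).mulVec x = 0 ↔ ∀ i j, G.Adj i j → x i = -x j := by
  constructor
  · intro h i j hij
    have h2 := two_mul_dotProduct_signlessLap_mulVec G x
    rw [h, dotProduct_zero, mul_zero, eq_comm, Finset.sum_eq_zero_iff_of_nonneg] at h2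
    · have h3 := h2 i (Finset.mem_univ i)
      rw [Finset.sum_eq_zero_iff_of_nonneg (fun j _ => by positivity)] at h3
      have h4 := h3 j (Finset.mem_univ j)
      rw [if_pos hij] at h4
      linarith [pow_eq_zero_iff (two_ne_zero) |>.mp h4]
    · intro i _
      exact Finset.sum_nonneg fun j _ => by positivity
  · intro h
    ext i
    rw [signlessLap_mulVec_apply, Pi.zero_apply]
    refine Finset.sum_eq_zero fun j _ => ?_
    split_ifs with hij
    · rw [h i j hij, neg_add_cancel]
    · rfl

/-- The connected components of a graph on which the induced subgraph is bipartite. -/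
abbrev BipartiteComponent {V : Type*} (G : SimpleGraph V) : Type _ :=
  {c : G.ConnectedComponent //
    (G.induce {v : V | G.connectedComponentMk v = c}).Colorable 2}

/-- A vector that changes sign along every edge vanishes on a component as soon as it vanishes
at one of its vertices. -/
lemma eq_zero_of_reachable {V : Type*} {G : SimpleGraph V} {x : V → ℝ}
    (hx : ∀ i j, G.Adj i j → x i = -x j) {u v : V} (h : G.Reachable u v) (hv : x v = 0) :
    x u = 0 := by
  obtain ⟨w⟩ := h
  induction w with
  | nil => exact hv
  | cons hadj _ ih => rw [hx _ _ hadj, ih hv, neg_zero]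

/-- The component of a vertex at which some edgewise sign-changing vector is nonzero is
bipartite. -/
lemma colorable_two_of_ne_zero {V : Type*} {G : SimpleGraph V} {x : V → ℝ}
    (hx : ∀ i j, G.Adj i j → x i = -x j) {v : V} (hv : x v ≠ 0) :
    (G.induce {u : V | G.connectedComponentMk u = G.connectedComponentMk v}).Colorable 2 := by
  refine SimpleGraph.Coloring.colorable (α := Bool)
    (SimpleGraph.Coloring.mk (fun u => decide (0 < x u)) ?_)
  rintro ⟨a, ha⟩ ⟨b, hb⟩ hab heq
  have hadj : G.Adj a b := hab
  have hb0 : x b ≠ 0 := fun h0 =>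
    hv (eq_zero_of_reachable hx (SimpleGraph.ConnectedComponent.exact hb).symm h0)
  have hiff : 0 < x a ↔ 0 < x b := by simpa using heq
  rw [hx a b hadj] at hiff
  rcases lt_or_gt_of_ne hb0 with h | h
  · linarith [hiff.mp (by linarith)]
  · linarith [hiff.mpr h]

/-- A graph carries a sign vector that changes sign along every edge of its bipartite
components. -/
lemma exists_sign_vector {V : Type*} (G : SimpleGraph V) :
    ∃ s : V → ℝ, (∀ v, s v * s v = 1) ∧ ∀ i j, G.Adj i j →
      (G.induce {u : V | G.connectedComponentMk u = G.connectedComponentMk i}).Colorable 2 →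
      s i = -s j := by
  have hex : ∀ c : G.ConnectedComponent, ∃ s : V → ℝ, (∀ v, s v * s v = 1) ∧
      ((G.induce {u : V | G.connectedComponentMk u = c}).Colorable 2 →
        ∀ i j, G.Adj i j → G.connectedComponentMk i = c → G.connectedComponentMk j = c →
          s i = -s j) := by
    intro c
    by_cases hc : (G.induce {u : V | G.connectedComponentMk u = c}).Colorable 2
    · obtain ⟨f⟩ := hc
      refine ⟨fun v => if h : G.connectedComponentMk v = c then
        (if f ⟨v, h⟩ = 0 then 1 else -1) else 1, fun v => ?_, fun _ i j hij hi hj => ?_⟩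
      · dsimp only
        split_ifs <;> norm_num
      · have hne : f ⟨i, hi⟩ ≠ f ⟨j, hj⟩ := f.valid hij
        simp only [hi, hj, dite_true]
        split_ifs with h1 h2 h2
        · exact absurd (h1.trans h2.symm) hne
        · norm_num
        · rfl
        · omega
    · exact ⟨fun _ => 1, fun _ => by norm_num, fun h => absurd h hc⟩
  choose s hs1 hs2 using hex
  refine ⟨fun v => s (G.connectedComponentMk v) v, fun v => hs1 _ v, fun i j hij hc => ?_⟩
  have hji : G.connectedComponentMk j = G.connectedComponentMk i :=
    (SimpleGraph.ConnectedComponent.sound hij.reachable).symm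
  dsimp only
  rw [hji]
  exact hs2 _ hc i j hij rfl hji

/-- The number of bipartite components is the nullity of the signless Laplacian. -/
theorem card_bipartiteComponent_eq_finrank_ker {V : Type*} [Fintype V] [DecidableEq V]
    (G : SimpleGraph V) :
    Nat.card (BipartiteComponent G) =
      Module.finrank ℝ (LinearMap.ker (signlessLap G).mulVecLin) := by
  let rep : BipartiteComponent G → V := fun c => c.1.out
  have hrep : ∀ c, G.connectedComponentMk (rep c) = c.1 := fun c => Quot.out_eq c.1
  let φ : LinearMap.ker (signlessLap G).mulVecLin →ₗ[ℝ] (BipartiteComponent G → ℝ) :=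
    (LinearMap.funLeft ℝ ℝ rep).comp (Submodule.subtype _)
  have hmem : ∀ x : V → ℝ, x ∈ LinearMap.ker (signlessLap G).mulVecLin ↔
      ∀ i j, G.Adj i j → x i = -x j := fun x => signlessLap_mulVec_eq_zero_iff G x
  have hinj : Function.Injective φ := by
    rw [injective_iff_map_eq_zero]
    rintro ⟨x, hx⟩ h0
    rw [hmem] at hx
    ext v
    by_contra hv
    have hv' : x v ≠ 0 := hv
    let c : BipartiteComponent G := ⟨_, colorable_two_of_ne_zero hx hv'⟩
    exact hv' (eq_zero_of_reachable hx
      (SimpleGraph.ConnectedComponent.exact (hrep c)).symm (congrFun h0 c))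
  have hsurj : Function.Surjective φ := by
    intro f
    obtain ⟨s, hs1, hs2⟩ := exists_sign_vector G
    let g : G.ConnectedComponent → ℝ := fun c =>
      if h : (G.induce {u : V | G.connectedComponentMk u = c}).Colorable 2 then
        f ⟨c, h⟩ * s (rep ⟨c, h⟩) else 0
    refine ⟨⟨fun v => g (G.connectedComponentMk v) * s v, (hmem _).mpr fun i j hij => ?_⟩, ?_⟩
    · rw [← SimpleGraph.ConnectedComponent.sound hij.reachable]
      by_cases h : (G.induce {u : V | G.connectedComponentMk u =
          G.connectedComponentMk i}).Colorable 2
      · rw [hs2 i j hij h]; ring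
      · simp [g, h]
    · ext c
      change g (G.connectedComponentMk (rep c)) * s (rep c) = f c
      rw [hrep]
      simp only [g, c.2, dite_true]
      rw [mul_assoc, hs1, mul_one]
  rw [(LinearEquiv.ofBijective φ ⟨hinj, hsurj⟩).finrank_eq, Module.finrank_fintype_fun_eq_card,
    Nat.card_eq_fintype_card]

/-- The signless Laplacians of degree-similar graphs have the same rank. -/
lemma DegreeSimilar.rank_signlessLap_eq {V : Type*} [Fintype V] [DecidableEq V]
    {G₁ G₂ : SimpleGraph V} (h : DegreeSimilar G₁ G₂) :
    (signlessLap G₁).rank = (signlessLap G₂).rank := by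
  obtain ⟨M, hM, hA, hD⟩ := h
  have hQ : M⁻¹ * signlessLap G₁ * M = signlessLap G₂ := by
    simp only [signlessLap, Matrix.mul_add, Matrix.add_mul, hA, hD]
  rw [← hQ, Matrix.rank_mul_eq_left_of_isUnit_det _ _ hM,
    Matrix.rank_mul_eq_right_of_isUnit_det _ _ (Matrix.isUnit_nonsing_inv_det M hM)]

/-- Degree-similar graphs have the same number of bipartite connected components:
components on whose vertex set the induced subgraph admits a proper 2-coloring. -/
theorem stmt16 {V : Type*} [Fintype V] [DecidableEq V]
    (G₁ G₂ : SimpleGraph V) (hds : DegreeSimilar G₁ G₂) :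
    Nat.card {c : G₁.ConnectedComponent //
        (G₁.induce {v : V | G₁.connectedComponentMk v = c}).Colorable 2} =
      Nat.card {c : G₂.ConnectedComponent //
        (G₂.induce {v : V | G₂.connectedComponentMk v = c}).Colorable 2} := by
  change Nat.card (BipartiteComponent G₁) = Nat.card (BipartiteComponent G₂)
  rw [card_bipartiteComponent_eq_finrank_ker, card_bipartiteComponent_eq_finrank_ker]
  have h₁ := (signlessLap G₁).mulVecLin.finrank_range_add_finrank_ker
  have h₂ := (signlessLap G₂).mulVecLin.finrank_range_add_finrank_ker
  have hr := hds.rank_signlessLap_eq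
  unfold Matrix.rank at hr
  omega
end

section
/- If G₁ and G₂ are degree-similar graphs on a common finite vertex set V and both are connected, then G₁ and G₂ have the same number of spanning trees: the number of edge subsets E' ⊆ E(G₁) such that the spanning subgraph (V, E') is a tree equals the number of edge subsets E'' ⊆ E(G₂) such that (V, E'') is a tree. -/
open scoped Classical

/-- `g` is a parent map of a spanning tree of `G` rooted at `r`: the root is fixed, every other
vertex is sent to a neighbour, and iterating `g` leads every vertex to the root. -/
def IsParentMap {V : Type*} (G : SimpleGraph V) (r : V) (g : V → V) : Prop :=
  g r = r ∧ (∀ v, v ≠ r → G.Adj v (g v)) ∧ ∀ v, ∃ k, g^[k] v = r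

/-- The edges joining each non-root vertex to its parent. -/
def parentEdges {V : Type*} (r : V) (g : V → V) : Set (Sym2 V) :=
  (fun v => s(v, g v)) '' {v | v ≠ r}

/-- A property of non-root vertices that is inherited by parents never holds. -/
theorem not_of_iterate_eq {V : Type*} {r : V} {g : V → V} (hg : ∀ v, ∃ k, g^[k] v = r)
    {P : V → Prop} (hr : ¬ P r) (hP : ∀ v, P v → P (g v)) (v : V) : ¬ P v := by
  intro hv
  obtain ⟨k, hk⟩ := hg v
  refine hr (hk ▸ ?_)
  clear hk
  induction k with
  | zero => exact hv
  | succ k ih => rw [Function.iterate_succ_apply']; exact hP _ ih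

theorem IsParentMap.eq_of_parentEdges_eq {V : Type*} {G : SimpleGraph V} {r : V} {g g' : V → V}
    (hg : IsParentMap G r g) (hg' : IsParentMap G r g')
    (h : parentEdges r g = parentEdges r g') : g = g' := by
  funext v
  by_contra hv
  refine not_of_iterate_eq hg.2.2 (P := fun v => v ≠ r ∧ g v ≠ g' v) (fun h => h.1 rfl) ?_ v
    ⟨fun hvr => hv (by rw [hvr, hg.1, hg'.1]), hv⟩
  rintro v ⟨hvr, hne⟩
  have hmem : s(v, g v) ∈ parentEdges r g' := h ▸ ⟨v, hvr, rfl⟩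
  obtain ⟨w, hwr, hw⟩ := hmem
  rcases Sym2.eq_iff.1 hw with ⟨rfl, h2⟩ | ⟨rfl, h2⟩
  · exact absurd h2.symm hne
  · refine ⟨hwr, fun h3 => ?_⟩
    have h4 : g (g v) = v := h3.trans h2
    refine not_of_iterate_eq hg.2.2 (P := fun u => u = v ∨ u = g v) ?_ ?_ v (Or.inl rfl)
    · rintro (h | h)
      · exact hvr h.symm
      · exact hwr h.symm
    · rintro u (rfl | rfl)
      · exact Or.inr rfl
      · exact Or.inl h4

theorem IsParentMap.parentEdges_subset {V : Type*} {G : SimpleGraph V} {r : V} {g : V → V}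
    (hg : IsParentMap G r g) : parentEdges r g ⊆ G.edgeSet := by
  rintro _ ⟨v, hv, rfl⟩
  exact hg.2.1 v hv

theorem IsParentMap.connected {V : Type*} {G : SimpleGraph V} {r : V} {g : V → V}
    (hg : IsParentMap G r g) : (SimpleGraph.fromEdgeSet (parentEdges r g)).Connected := by
  have key : ∀ v, (SimpleGraph.fromEdgeSet (parentEdges r g)).Reachable v r := by
    intro v
    by_contra hv
    refine not_of_iterate_eq hg.2.2
      (P := fun v => ¬ (SimpleGraph.fromEdgeSet (parentEdges r g)).Reachable v r)
      (fun h => h (SimpleGraph.Reachable.refl r)) (fun u hu hgu => hu ?_) v hv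
    by_cases hur : u = r
    · rw [hur]
    · refine SimpleGraph.Reachable.trans (SimpleGraph.Adj.reachable ?_) hgu
      rw [SimpleGraph.fromEdgeSet_adj]
      exact ⟨⟨u, hur, rfl⟩, (hg.2.1 u hur).ne⟩
  exact (SimpleGraph.connected_iff _).2 ⟨fun u v => (key u).trans (key v).symm, ⟨r⟩⟩

theorem fromEdgeSet_edgeSet_of_subset {V : Type*} {G : SimpleGraph V} {E : Set (Sym2 V)}
    (hE : E ⊆ G.edgeSet) : (SimpleGraph.fromEdgeSet E).edgeSet = E := by
  rw [SimpleGraph.edgeSet_fromEdgeSet, sdiff_eq_left, Set.disjoint_left]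
  intro e he
  exact G.not_isDiag_of_mem_edgeSet (hE he)

theorem IsParentMap.isTree {V : Type*} [Finite V] {G : SimpleGraph V} {r : V} {g : V → V}
    (hg : IsParentMap G r g) : (SimpleGraph.fromEdgeSet (parentEdges r g)).IsTree := by
  rw [SimpleGraph.isTree_iff_connected_and_card]
  refine ⟨hg.connected, le_antisymm ?_ hg.connected.card_vert_le_card_edgeSet_add_one⟩
  rw [fromEdgeSet_edgeSet_of_subset hg.parentEdges_subset, Nat.card_coe_set_eq]
  have h1 : (parentEdges r g).ncard ≤ ({v | v ≠ r} : Set V).ncard := Set.ncard_image_le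
  have h2 : ({v | v ≠ r} : Set V).ncard + 1 = Nat.card V := by
    have := Set.ncard_add_ncard_compl ({r} : Set V)
    rw [Set.ncard_singleton, add_comm] at this
    exact this
  omega

theorem exists_isParentMap_of_isTree {V : Type*} {G : SimpleGraph V} {E : Set (Sym2 V)}
    (hE : E ⊆ G.edgeSet) (hT : (SimpleGraph.fromEdgeSet E).IsTree) (r : V) :
    ∃ g, IsParentMap G r g ∧ parentEdges r g = E := by
  set T := SimpleGraph.fromEdgeSet E with hTdef
  have hTE : T.edgeSet = E := fromEdgeSet_edgeSet_of_subset hE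
  have hstep : ∀ v, ∃ u, (v = r → u = r) ∧ (v ≠ r → T.Adj v u ∧ T.dist u r < T.dist v r) := by
    intro v
    by_cases hv : v = r
    · exact ⟨r, fun _ => rfl, fun h => absurd hv h⟩
    · obtain ⟨p, hp⟩ := hT.1.exists_walk_length_eq_dist v r
      cases p with
      | nil => exact absurd rfl hv
      | @cons _ u _ hadj q =>
        refine ⟨u, fun h => absurd h hv, fun _ => ⟨hadj, ?_⟩⟩
        rw [← hp, SimpleGraph.Walk.length_cons]
        exact Nat.lt_succ_of_le (SimpleGraph.dist_le q)
  choose g hgr hg using hstep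
  have hpar : IsParentMap T r g := by
    refine ⟨hgr r rfl, fun v hv => (hg v hv).1, fun v => ?_⟩
    induction hd : T.dist v r using Nat.strong_induction_on generalizing v with
    | _ d ih =>
      by_cases hv : v = r
      · exact ⟨0, hv⟩
      · obtain ⟨k, hk⟩ := ih _ (hd ▸ (hg v hv).2) (g v) rfl
        exact ⟨k + 1, hk⟩
  have hTG : T ≤ G := SimpleGraph.edgeSet_subset_edgeSet.1 (hTE.symm ▸ hE)
  refine ⟨g, ⟨hpar.1, fun v hv => hTG (hpar.2.1 v hv), hpar.2.2⟩, ?_⟩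
  have hle : SimpleGraph.fromEdgeSet (parentEdges r g) ≤ T := by
    rw [hTdef]
    exact SimpleGraph.fromEdgeSet_mono (hTE ▸ hpar.parentEdges_subset)
  have heq := le_antisymm hle ((SimpleGraph.isTree_iff_minimal_connected.1 hT).2
    hpar.connected hle)
  rw [← fromEdgeSet_edgeSet_of_subset hpar.parentEdges_subset, heq, hTE]

theorem card_isParentMap {V : Type*} [Finite V] (G : SimpleGraph V) (r : V) :
    Nat.card {g // IsParentMap G r g} =
      Nat.card {E : Set (Sym2 V) // E ⊆ G.edgeSet ∧ (SimpleGraph.fromEdgeSet E).IsTree} := by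
  refine Nat.card_eq_of_bijective
    (fun g => ⟨parentEdges r g.1, g.2.parentEdges_subset, g.2.isTree⟩) ⟨?_, ?_⟩
  · rintro ⟨g, hg⟩ ⟨g', hg'⟩ h
    exact Subtype.ext (hg.eq_of_parentEdges_eq hg' (congrArg Subtype.val h))
  · rintro ⟨E, hE, hT⟩
    obtain ⟨g, hg, h⟩ := exists_isParentMap_of_isTree hE hT r
    exact ⟨⟨g, hg⟩, Subtype.ext h⟩

/-- The rows of the Laplacian of the functional graph of `g`, with the row of `r` replaced by
the corresponding basis vector. -/
noncomputable def rootedRow {V : Type*} [DecidableEq V] (r v u : V) : V → ℝ :=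
  if v = r then Pi.single r 1 else Pi.single v 1 - Pi.single u 1

theorem det_rootedRow_eq_one {V : Type*} [Fintype V] [DecidableEq V] {r : V} {g : V → V}
    (hne : ∀ v, v ≠ r → g v ≠ v) (hg : ∀ v, ∃ k, g^[k] v = r) :
    Matrix.det (Matrix.of fun v => rootedRow r v (g v)) = 1 := by
  rw [← Matrix.det_transpose, Matrix.det_apply', Finset.sum_eq_single 1]
  · simp only [Equiv.Perm.sign_one, Units.val_one, Int.cast_one, one_mul, Equiv.Perm.coe_one, id]
    refine Finset.prod_eq_one fun v _ => ?_
    by_cases hv : v = r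
    · simp [rootedRow, hv]
    · simp [rootedRow, hv, (hne v hv).symm]
  · intro σ _ hσ
    by_contra h0
    have hprod := right_ne_zero_of_mul h0
    rw [Finset.prod_ne_zero_iff] at hprod
    have hr : σ r = r := by
      by_contra h
      exact hprod r (Finset.mem_univ r) (by simp [rootedRow, h])
    have hmove : ∀ v, σ v ≠ v → σ v = g v := by
      intro v hv
      have hvr : v ≠ r := fun h => hv (h ▸ hr)
      by_contra h
      exact hprod v (Finset.mem_univ v) (by simp [rootedRow, h, hvr, hv])
    refine hσ (Equiv.ext fun v => ?_)
    have := not_of_iterate_eq hg (P := fun v => σ v ≠ v) (fun h => h hr)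
      (fun v hv => by rw [← hmove v hv]; exact fun h => hv (σ.injective h)) v
    exact not_not.1 this
  · simp

theorem det_rootedRow_eq_zero {V : Type*} [Fintype V] [DecidableEq V] {r : V} {g : V → V}
    (hg : ¬ ∀ v, ∃ k, g^[k] v = r) :
    Matrix.det (Matrix.of fun v => rootedRow r v (g v)) = 0 := by
  obtain ⟨w, hw⟩ := not_forall.1 hg
  refine Matrix.exists_mulVec_eq_zero_iff.1
    ⟨fun v => if ∃ k, g^[k] v = r then 0 else 1, fun h => ?_, ?_⟩
  · have := congrFun h w
    simp [hw] at this
  · funext v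
    by_cases hv : v = r
    · have : ∃ k, g^[k] r = r := ⟨0, rfl⟩
      simp [Matrix.mulVec, rootedRow, hv, this]
    · have hiff : (∃ k, g^[k] v = r) ↔ ∃ k, g^[k] (g v) = r := by
        refine ⟨?_, fun ⟨k, hk⟩ => ⟨k + 1, hk⟩⟩
        rintro ⟨k, hk⟩
        cases k with
        | zero => exact absurd hk hv
        | succ k => exact ⟨k, hk⟩
      have hrow : rootedRow r v (g v) = Pi.single v 1 - Pi.single (g v) 1 := if_neg hv
      change rootedRow r v (g v) ⬝ᵥ _ = 0
      rw [hrow, sub_dotProduct, single_dotProduct, single_dotProduct]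
      simp only [hiff, sub_self]

/-- **Matrix-tree theorem**: the diagonal cofactors of the Laplacian count spanning trees. -/
theorem adjugate_laplacian_apply_self {V : Type*} [Fintype V] [DecidableEq V]
    (G : SimpleGraph V) (r : V) :
    (degMatrix G - G.adjMatrix ℝ).adjugate r r =
      Nat.card {E : Set (Sym2 V) // E ⊆ G.edgeSet ∧ (SimpleGraph.fromEdgeSet E).IsTree} := by
  rw [← card_isParentMap G r, Matrix.adjugate_apply]
  have hrows : (degMatrix G - G.adjMatrix ℝ).updateRow r (Pi.single r 1) =
      fun v => ∑ u ∈ (if v = r then {r} else G.neighborFinset v), rootedRow r v u := by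
    funext v
    by_cases hv : v = r
    · subst hv
      simp [rootedRow]
    · funext w
      have h1 : ∑ u ∈ G.neighborFinset v, (Pi.single u (1 : ℝ) : V → ℝ) w =
          if G.Adj v w then 1 else 0 := by
        simp [Pi.single_apply]
      rw [Matrix.updateRow_ne hv, if_neg hv, Finset.sum_apply]
      simp only [rootedRow, if_neg hv, Pi.sub_apply, Finset.sum_sub_distrib, h1]
      simp [degMatrix, Matrix.diagonal_apply, Pi.single_apply, eq_comm]
  have hexp := (Matrix.detRowAlternating (R := ℝ) (n := V)).toMultilinearMap.map_sum_finset
    (rootedRow r) (fun v => if v = r then {r} else G.neighborFinset v)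
  rw [hrows]
  refine hexp.trans ?_
  have hterm : ∀ g ∈ Fintype.piFinset (fun v => if v = r then {r} else G.neighborFinset v),
      Matrix.detRowAlternating.toMultilinearMap (fun v => rootedRow r v (g v)) =
        if IsParentMap G r g then (1 : ℝ) else 0 := by
    intro g hg
    rw [Fintype.mem_piFinset] at hg
    have hr : g r = r := by simpa using hg r
    have hadj : ∀ v, v ≠ r → G.Adj v (g v) := fun v hv => by simpa [hv] using hg v
    by_cases h : ∀ v, ∃ k, g^[k] v = r
    · rw [if_pos ⟨hr, hadj, h⟩]
      exact det_rootedRow_eq_one (fun v hv => (hadj v hv).ne') h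
    · rw [if_neg fun h' => h h'.2.2]
      exact det_rootedRow_eq_zero h
  rw [Finset.sum_congr rfl hterm, Finset.sum_boole, Nat.card_eq_fintype_card,
    Fintype.card_subtype]
  congr 2
  ext g
  simp only [Finset.mem_filter, Finset.mem_univ, true_and, and_iff_right_iff_imp,
    Fintype.mem_piFinset]
  intro hg v
  by_cases hv : v = r
  · subst hv
    simpa using hg.1
  · simpa [hv] using hg.2.1 v hv

theorem trace_adjugate_conj {n R : Type*} [Fintype n] [DecidableEq n] [CommRing R]
    (M A : Matrix n n R) (hM : IsUnit M.det) :
    (M⁻¹ * A * M).adjugate.trace = A.adjugate.trace := by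
  rw [Matrix.adjugate_mul_distrib, Matrix.adjugate_mul_distrib, Matrix.trace_mul_comm,
    Matrix.mul_assoc, ← Matrix.adjugate_mul_distrib, Matrix.mul_nonsing_inv M hM,
    Matrix.adjugate_one, Matrix.mul_one]

/-- Connected degree-similar graphs have the same number of spanning trees: subsets of
the edge set whose associated spanning subgraph is a tree. -/
theorem stmt17 {V : Type*} [Fintype V] [DecidableEq V]
    (G₁ G₂ : SimpleGraph V) (hds : DegreeSimilar G₁ G₂)
    (h₁ : G₁.Connected) (h₂ : G₂.Connected) :
    Nat.card {E' : Set (Sym2 V) // E' ⊆ G₁.edgeSet ∧ (SimpleGraph.fromEdgeSet E').IsTree} =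
      Nat.card {E' : Set (Sym2 V) // E' ⊆ G₂.edgeSet ∧ (SimpleGraph.fromEdgeSet E').IsTree} := by
  obtain ⟨M, hM, hA, hD⟩ := hds
  have hcount (G : SimpleGraph V) : (degMatrix G - G.adjMatrix ℝ).adjugate.trace =
      Fintype.card V * (Nat.card {E' : Set (Sym2 V) //
        E' ⊆ G.edgeSet ∧ (SimpleGraph.fromEdgeSet E').IsTree} : ℝ) := by
    simp [Matrix.trace, adjugate_laplacian_apply_self]
  have htrace := trace_adjugate_conj M (degMatrix G₁ - G₁.adjMatrix ℝ) hM
  rw [Matrix.mul_sub, Matrix.sub_mul, hA, hD, hcount, hcount] at htrace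
  have := h₁.nonempty
  have hV : (Fintype.card V : ℝ) ≠ 0 := Nat.cast_ne_zero.2 Fintype.card_ne_zero
  exact_mod_cast (mul_left_cancel₀ hV htrace).symm
end

section
/- If G₁ and G₂ are degree-similar graphs on a common finite vertex set V and both are connected, then for every integer k ≥ 0 the number of walks of length k in G₁ equals the number of walks of length k in G₂; equivalently, 𝟙ᵀA(G₁)ᵏ𝟙 = 𝟙ᵀA(G₂)ᵏ𝟙, where 𝟙 is the all-one vector. -/
open scoped Classical

theorem degMatrix_sub_adjMatrix {V : Type*} [Fintype V] [DecidableEq V] (G : SimpleGraph V) :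
    degMatrix G - G.adjMatrix ℝ = G.lapMatrix ℝ :=
  rfl

theorem exists_eq_const_of_lapMatrix_mulVec_eq_zero {V : Type*} [Fintype V] [DecidableEq V]
    {G : SimpleGraph V} (hG : G.Connected) {x : V → ℝ}
    (hx : (G.lapMatrix ℝ).mulVec x = 0) : ∃ c : ℝ, x = fun _ => c := by
  rw [G.lapMatrix_mulVec_eq_zero_iff_forall_reachable] at hx
  obtain ⟨v⟩ := hG.nonempty
  exact ⟨x v, funext fun u => hx u v (hG.preconnected u v)⟩

/-- Connected degree-similar graphs have the same number of walks of every length `k`: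
the sum of all entries of `A(G₁)^k` equals the sum of all entries of `A(G₂)^k`. -/
theorem stmt18 {V : Type*} [Fintype V] [DecidableEq V]
    (G₁ G₂ : SimpleGraph V) (hds : DegreeSimilar G₁ G₂)
    (h₁ : G₁.Connected) (h₂ : G₂.Connected) :
    ∀ k : ℕ, ∑ u : V, ∑ v : V, ((G₁.adjMatrix ℝ) ^ k) u v =
      ∑ u : V, ∑ v : V, ((G₂.adjMatrix ℝ) ^ k) u v := by
  obtain ⟨M, hM, hA, hD⟩ := hds
  have intertwine {B C : Matrix V V ℝ} (h : M⁻¹ * B * M = C) : B * M = M * C := by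
    rw [← h, Matrix.mul_assoc, Matrix.mul_nonsing_inv_cancel_left _ _ hM]
  have hL : G₁.lapMatrix ℝ * M = M * G₂.lapMatrix ℝ := by
    rw [← degMatrix_sub_adjMatrix, ← degMatrix_sub_adjMatrix, Matrix.sub_mul, Matrix.mul_sub,
      intertwine hA, intertwine hD]
  obtain ⟨c, hc⟩ : ∃ c : ℝ, M.mulVec (fun _ => 1) = fun _ => c := by
    refine exists_eq_const_of_lapMatrix_mulVec_eq_zero h₁ ?_
    rw [Matrix.mulVec_mulVec, hL, ← Matrix.mulVec_mulVec, G₂.lapMatrix_mulVec_const_eq_zero,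
      Matrix.mulVec_zero]
  obtain ⟨d, hd⟩ : ∃ d : ℝ, Matrix.vecMul (fun _ => 1) M = fun _ => d := by
    refine exists_eq_const_of_lapMatrix_mulVec_eq_zero h₂ ?_
    rw [← (G₂.isSymm_lapMatrix ℝ).eq, Matrix.mulVec_transpose, Matrix.vecMul_vecMul, ← hL,
      ← Matrix.vecMul_vecMul, ← Matrix.mulVec_transpose (G₁.lapMatrix ℝ), (G₁.isSymm_lapMatrix ℝ).eq,
      G₁.lapMatrix_mulVec_const_eq_zero, Matrix.zero_vecMul]
  have hconst (a : ℝ) : (fun _ : V => a) = a • (fun _ => 1) := by ext; simp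
  have := h₁.nonempty
  have hcd : d = c := by
    have h := Matrix.dotProduct_mulVec (fun _ => (1 : ℝ)) M (fun _ => 1)
    rw [hc, hd] at h
    simpa [dotProduct, eq_comm] using h
  have hc0 : c ≠ 0 := by
    rintro rfl
    obtain ⟨v⟩ := this
    have h := Matrix.eq_zero_of_mulVec_eq_zero hM.ne_zero hc
    simpa using congrFun h v
  have hpow (k : ℕ) : G₁.adjMatrix ℝ ^ k * M = M * G₂.adjMatrix ℝ ^ k :=
    (SemiconjBy.pow_right (intertwine hA).symm k).symm
  have hsum (B : Matrix V V ℝ) :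
      ∑ u, ∑ v, B u v = (fun _ => (1 : ℝ)) ⬝ᵥ B.mulVec (fun _ => 1) := by
    simp [dotProduct, Matrix.mulVec]
  intro k
  refine mul_left_cancel₀ hc0 ?_
  rw [hsum, hsum, ← smul_eq_mul, ← smul_eq_mul, ← dotProduct_smul, ← Matrix.mulVec_smul,
    ← hconst, ← hc, Matrix.mulVec_mulVec, hpow, ← Matrix.mulVec_mulVec, Matrix.dotProduct_mulVec,
    hd, hcd, hconst c, smul_dotProduct]
end
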